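/- arXiv:0904.3012 — 2 statements merged into one kernel-verified Lean document; each statement's English description precedes it below -/
import Mathlib

section
/- There exists a planar hypohamiltonian graph on 42 vertices. -/
open SimpleGraph

/-- A graph is hypohamiltonian if it is not Hamiltonian, but deleting any vertex
gives a Hamiltonian graph. -/
def SimpleGraph.IsHypohamiltonian {V : Type*} [Fintype V] [DecidableEq V]
    (G : SimpleGraph V) : Prop :=
  ¬ G.IsHamiltonian ∧ ∀ v : V, (G.induce {u | u ≠ v}).IsHamiltonian

open SimpleGraph Set

/-- A drawing of a simple graph in the plane: vertices are mapped to distinct points,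
each edge is drawn as a simple arc between the points of its endpoints, distinct edges
meet only in common endpoints, and no vertex point lies on an arc of a non-incident edge. -/
structure SimpleGraph.PlaneEmbedding {V : Type*} (G : SimpleGraph V) where
  vpos : V → ℝ × ℝ
  vpos_inj : Function.Injective vpos
  arc : Sym2 V → Set (ℝ × ℝ)
  arc_spec : ∀ e ∈ G.edgeSet, ∀ u v : V, e = s(u, v) →
    ∃ γ : ℝ → ℝ × ℝ, ContinuousOn γ (Set.Icc 0 1) ∧ Set.InjOn γ (Set.Icc 0 1) ∧
      γ '' Set.Icc 0 1 = arc e ∧ γ 0 = vpos u ∧ γ 1 = vpos v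
  arc_inter : ∀ e ∈ G.edgeSet, ∀ f ∈ G.edgeSet, e ≠ f →
    arc e ∩ arc f ⊆ {p | ∃ v, v ∈ e ∧ v ∈ f ∧ p = vpos v}
  vpos_mem_arc : ∀ e ∈ G.edgeSet, ∀ v : V, vpos v ∈ arc e → v ∈ e

/-- A graph is planar if it admits a plane embedding. -/
def SimpleGraph.IsPlanar {V : Type*} (G : SimpleGraph V) : Prop :=
  Nonempty G.PlaneEmbedding

namespace SimpleGraph.PlaneEmbedding

variable {V : Type*} {G : SimpleGraph V} (E : G.PlaneEmbedding)

/-- The set of points of the plane used by the drawing. -/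
def drawing : Set (ℝ × ℝ) :=
  Set.range E.vpos ∪ ⋃ e ∈ G.edgeSet, E.arc e

/-- The faces of a plane embedding are the connected components of the complement
of the drawing. -/
def IsFace (F : Set (ℝ × ℝ)) : Prop :=
  ∃ x ∉ E.drawing, F = connectedComponentIn E.drawingᶜ x

/-- The size of a face: the number of edges of the graph whose arc lies on the
boundary of the face. -/
noncomputable def faceSize (F : Set (ℝ × ℝ)) : ℕ :=
  {e | e ∈ G.edgeSet ∧ E.arc e ⊆ frontier F}.ncard

/-- The curve (Jordan curve) drawn by a closed walk. -/
def curve {a : V} (p : G.Walk a a) : Set (ℝ × ℝ) :=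
  ⋃ e ∈ p.edges, E.arc e

/-- A face lies inside the cycle `p` if all of its points lie in a bounded
connected component of the complement of the curve of `p`. -/
def FaceInside {a : V} (p : G.Walk a a) (F : Set (ℝ × ℝ)) : Prop :=
  ∀ x ∈ F, Bornology.IsBounded (connectedComponentIn (E.curve p)ᶜ x)

/-- A face lies outside the cycle `p` if all of its points lie in an unbounded
connected component of the complement of the curve of `p`. -/
def FaceOutside {a : V} (p : G.Walk a a) (F : Set (ℝ × ℝ)) : Prop :=
  ∀ x ∈ F, ¬ Bornology.IsBounded (connectedComponentIn (E.curve p)ᶜ x)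

end SimpleGraph.PlaneEmbedding

namespace SimpleGraph

variable {V E F : Type*}

/-- The mod 2 boundary map of a multigraph whose edge `e` joins `a e` to `b e`. -/
def boundary [DecidableEq V] [Fintype E] (a b : E → V) : (E → ZMod 2) →ₗ[ZMod 2] (V → ZMod 2) :=
  Fintype.linearCombination (ZMod 2) fun e ↦ Pi.single (a e) 1 + Pi.single (b e) 1

lemma sum_mul_boundary [Fintype V] [DecidableEq V] [Fintype E] (a b : E → V) (c : E → ZMod 2)
    (x : V → ZMod 2) :
    ∑ v, x v * boundary a b c v = ∑ e, c e * (x (a e) + x (b e)) := by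
  simp only [boundary, Fintype.linearCombination_apply, Finset.sum_apply, Pi.smul_apply,
    Pi.add_apply, smul_eq_mul, Finset.mul_sum]
  rw [Finset.sum_comm]
  refine Finset.sum_congr rfl fun e _ ↦ ?_
  simp [Pi.single_apply, mul_add, Finset.sum_add_distrib, mul_comm]

lemma boundary_apply [Fintype V] [DecidableEq V] [Fintype E] (a b : E → V) (c : E → ZMod 2)
    (v : V) :
    boundary a b c v = ∑ e, c e * ((if a e = v then 1 else 0) + if b e = v then 1 else 0) := by
  simpa using sum_mul_boundary a b c fun w ↦ if w = v then 1 else 0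

/-- If `P` and `Q` split the identity on edges, then every mod 2 cycle of the multigraph
`(a, b)` is a coboundary in the multigraph `(l, r)` with the same edges. -/
lemma exists_potential [Fintype V] [DecidableEq V] [Fintype E] [DecidableEq E] (a b : E → V)
    (l r : E → F) (P : V → E → ZMod 2) (Q : F → E → ZMod 2)
    (hPQ : ∀ e e', P (a e') e + P (b e') e + (Q (l e) e' + Q (r e) e') = if e = e' then 1 else 0)
    {c : E → ZMod 2} (hc : boundary a b c = 0) :
    ∃ s : F → ZMod 2, ∀ e, c e = s (l e) + s (r e) := by
  refine ⟨fun f ↦ ∑ e', c e' * Q f e', fun e ↦ ?_⟩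
  have h := sum_mul_boundary a b c fun v ↦ P v e
  simp only [hc, Pi.zero_apply, mul_zero, Finset.sum_const_zero] at h
  calc c e = ∑ e', c e' * (P (a e') e + P (b e') e + (Q (l e) e' + Q (r e) e')) := by simp [hPQ]
    _ = _ := by simp only [mul_add, Finset.sum_add_distrib] at h ⊢; rw [← h, zero_add]

/-- A function on the vertices which is constant along the edges of a walk is constant on its
support. -/
lemma Walk.eq_of_forall_mem_edges {α : Type*} {G : SimpleGraph V} (x : V → α) {u v : V}
    (p : G.Walk u v) (h : ∀ w w', s(w, w') ∈ p.edges → x w = x w') :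
    ∀ w ∈ p.support, x w = x u := by
  induction p with
  | nil => simp
  | cons huv p ih =>
    intro w hw
    rw [Walk.support_cons, List.mem_cons] at hw
    obtain rfl | hw := hw
    · rfl
    · rw [ih (fun w w' hww' ↦ h w w' (by simp [hww'])) w hw]
      exact (h _ _ (by simp)).symm

/-- If no nonzero mod 2 chain supported on `{e | p e}` is a cycle, that is, if these edges form a
forest, then they are fewer than the vertices of any nonempty set `{f | q f}` they lie in. -/
lemma card_add_one_le_of_boundary_injOn [Fintype E] [Fintype F] [DecidableEq F] (l r : E → F)
    (p : E → Prop) (q : F → Prop) [DecidablePred p] [DecidablePred q] (hl : ∀ e, p e → q (l e)) (hr : ∀ e, p e → q (r e))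
    (hq : ∃ f, q f) (h : ∀ d : E → ZMod 2, (∀ e, ¬ p e → d e = 0) → boundary l r d = 0 → d = 0) :
    Fintype.card {e // p e} + 1 ≤ Fintype.card {f // q f} := by
  obtain ⟨f₀, hf₀⟩ := hq
  let φ : ({e // p e} → ZMod 2) × ZMod 2 →ₗ[ZMod 2] ({f // q f} → ZMod 2) :=
    (LinearMap.funLeft (ZMod 2) (ZMod 2) (Subtype.val : {f // q f} → F)).comp
      (((boundary l r).comp (Function.ExtendByZero.linearMap (ZMod 2) Subtype.val)).coprod
        (LinearMap.toSpanSingleton (ZMod 2) (F → ZMod 2) (Pi.single f₀ 1)))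
  have hφ : Function.Injective φ := by
    rw [← LinearMap.ker_eq_bot, LinearMap.ker_eq_bot']
    rintro ⟨d, t⟩ hdt
    set D : E → ZMod 2 := Function.extend Subtype.val d 0 with hD
    have hD0 : ∀ e, ¬ p e → D e = 0 := fun e he ↦
      Function.extend_apply' _ _ _ (by rintro ⟨⟨e', he'⟩, rfl⟩; exact he he')
    have hin : ∀ f, q f → boundary l r D f + t * (if f = f₀ then 1 else 0) = 0 := fun f hf ↦ by
      have : boundary l r D f + t * Pi.single (M := fun _ ↦ ZMod 2) f₀ 1 f = 0 :=
        congrFun hdt ⟨f, hf⟩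
      rwa [Pi.single_apply] at this
    have ht : t = 0 := by
      have h1 := sum_mul_boundary l r D fun f ↦ if q f then 1 else 0
      have h2 : ∑ e, D e * ((if q (l e) then 1 else 0) + if q (r e) then 1 else 0) = 0 :=
        Finset.sum_eq_zero fun e _ ↦ by
          by_cases he : p e
          · rw [if_pos (hl e he), if_pos (hr e he), CharTwo.add_self_eq_zero, mul_zero]
          · rw [hD0 e he, zero_mul]
      have h3 : ∑ f, (if q f then 1 else 0) * (boundary l r D f + t * (if f = f₀ then 1 else 0))
          = 0 := Finset.sum_eq_zero fun f _ ↦ by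
        by_cases hf : q f
        · rw [hin f hf, mul_zero]
        · simp [hf]
      simp only [mul_add, Finset.sum_add_distrib] at h3 h2 h1
      rw [h1, h2] at h3
      simpa [hf₀] using h3
    have hbd : boundary l r D = 0 := by
      funext f
      by_cases hf : q f
      · simpa [ht] using hin f hf
      · rw [boundary_apply]
        refine Finset.sum_eq_zero fun e _ ↦ ?_
        by_cases he : p e
        · have h1 : l e ≠ f := fun h' ↦ hf (h' ▸ hl e he)
          have h2 : r e ≠ f := fun h' ↦ hf (h' ▸ hr e he)
          simp [h1, h2]
        · rw [hD0 e he, zero_mul]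
    have hD1 := h D hD0 hbd
    refine Prod.ext (funext fun e ↦ ?_) ht
    exact (Subtype.val_injective.extend_apply d 0 e).symm.trans (congrFun hD1 e)
  simpa using LinearMap.finrank_le_finrank_of_injective hφ

/-- The indicator of the edge set of a closed trail is a mod 2 cycle. -/
lemma Walk.IsTrail.boundary_eq_zero [Fintype V] [DecidableEq V] [Fintype E] {G : SimpleGraph V}
    {a b : E → V} (hinj : Function.Injective fun e ↦ s(a e, b e))
    (hG : G.edgeSet = Set.range fun e ↦ s(a e, b e))
    {u : V} {p : G.Walk u u} (hp : p.IsTrail) :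
    boundary a b (fun e ↦ if s(a e, b e) ∈ p.edges then 1 else 0) = 0 := by
  funext v
  have heven : Even (p.edges.countP fun e ↦ v ∈ e) := by simp [hp.even_countP_edges_iff]
  have hcount : p.edges.countP (fun e ↦ v ∈ e) =
      (Finset.univ.filter fun e ↦ s(a e, b e) ∈ p.edges ∧ v ∈ s(a e, b e)).card := by
    rw [List.countP_eq_length_filter, ← List.toFinset_card_of_nodup (hp.edges_nodup.filter _),
      ← Finset.card_image_of_injective _ hinj]
    congr 1
    ext e
    simp only [List.mem_toFinset, List.mem_filter, decide_eq_true_eq, Finset.mem_image,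
      Finset.mem_filter, Finset.mem_univ, true_and]
    constructor
    · rintro ⟨he, hv⟩
      obtain ⟨i, rfl⟩ := hG ▸ p.edges_subset_edgeSet he
      exact ⟨i, ⟨he, hv⟩, rfl⟩
    · rintro ⟨i, hi, rfl⟩
      exact hi
  rw [hcount] at heven
  rw [boundary_apply, Pi.zero_apply]
  refine Eq.trans ?_ (ZMod.natCast_eq_zero_iff_even.2 heven)
  rw [Finset.card_filter, Nat.cast_sum]
  refine Finset.sum_congr rfl fun e _ ↦ ?_
  have hne : a e ≠ b e := G.ne_of_adj (show s(a e, b e) ∈ G.edgeSet from hG ▸ ⟨e, rfl⟩)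
  by_cases he : s(a e, b e) ∈ p.edges
  · by_cases h1 : a e = v
    · subst h1
      simp [he, hne.symm]
    · simp [he, h1, Ne.symm h1, eq_comm]
  · simp [he]

/-- Grinberg's criterion. The planar structure is given by the faces `l e` and `r e` on the two
sides of each edge `e`, subject to Euler's formula and to the exactness of the mod 2 chain complexes
of the graph and of its dual. A Hamiltonian cycle splits the faces into two classes. -/
theorem Walk.IsHamiltonianCycle.grinberg [Fintype V] [DecidableEq V] [Fintype E] [Fintype F]
    [DecidableEq F] {G : SimpleGraph V} {a b : E → V} {l r : E → F}
    (hinj : Function.Injective fun e ↦ s(a e, b e)) (hG : G.edgeSet = Set.range fun e ↦ s(a e, b e))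
    (hcycle : ∀ c : E → ZMod 2, boundary a b c = 0 → ∃ s : F → ZMod 2, ∀ e, c e = s (l e) + s (r e))
    (hcut : ∀ d : E → ZMod 2, boundary l r d = 0 → ∃ x : V → ZMod 2, ∀ e, d e = x (a e) + x (b e))
    (heuler : Fintype.card V + Fintype.card F = Fintype.card E + 2)
    {u : V} {p : G.Walk u u} (hp : p.IsHamiltonianCycle) :
    ∃ s : F → ZMod 2, ∀ i, (∑ f with s f = i,
      ∑ e, ((if l e = f then 1 else 0) + if r e = f then 1 else 0)) + 2 =
        Fintype.card V + 2 * (Finset.univ.filter fun f ↦ s f = i).card := by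
  set c : E → ZMod 2 := fun e ↦ if s(a e, b e) ∈ p.edges then 1 else 0 with hc
  obtain ⟨s, hs⟩ := hcycle c (hp.isCycle.isTrail.boundary_eq_zero hinj hG)
  have hc01 : ∀ e, c e = 0 ∨ c e = 1 := fun e ↦ by by_cases h : s(a e, b e) ∈ p.edges <;> simp [hc, h]
  have hmem : ∀ e, s(a e, b e) ∈ p.edges ↔ c e = 1 := fun e ↦ by simp [hc]
  have hcard : (Finset.univ.filter fun e ↦ c e = 1).card = Fintype.card V := by
    rw [← hp.length_eq, ← Walk.length_edges,
      ← List.toFinset_card_of_nodup hp.isCycle.isTrail.edges_nodup,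
      ← Finset.card_image_of_injective _ hinj]
    congr 1
    ext e
    simp only [Finset.mem_image, Finset.mem_filter, Finset.mem_univ, true_and, List.mem_toFinset,
      ← hmem]
    constructor
    · rintro ⟨i, hi, rfl⟩
      exact hi
    · intro he
      obtain ⟨i, rfl⟩ := hG ▸ p.edges_subset_edgeSet he
      exact ⟨i, he, rfl⟩
  obtain ⟨e₁, he₁⟩ : ∃ e, c e = 1 := by
    have : 0 < (Finset.univ.filter fun e ↦ c e = 1).card :=
      hcard ▸ Fintype.card_pos_iff.2 ⟨u⟩
    obtain ⟨e, he⟩ := Finset.card_pos.1 this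
    exact ⟨e, (Finset.mem_filter.1 he).2⟩
  have hsurj : ∀ i, ∃ f, s f = i := by
    have h2 : ∀ x y i : ZMod 2, x + y = 1 → x = i ∨ y = i := by decide
    intro i
    exact (h2 _ _ i ((hs e₁).symm.trans he₁)).elim (fun h ↦ ⟨_, h⟩) fun h ↦ ⟨_, h⟩
  have heq : ∀ e, c e = 0 → s (l e) = s (r e) := fun e he ↦
    CharTwo.add_eq_zero.1 ((hs e).symm.trans he)
  have hforest : ∀ d : E → ZMod 2, (∀ e, c e = 1 → d e = 0) → boundary l r d = 0 → d = 0 := by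
    intro d hd hd0
    obtain ⟨x, hx⟩ := hcut d hd0
    have hconst : ∀ w, x w = x u := fun w ↦
      p.eq_of_forall_mem_edges x (fun w w' h ↦ by
        obtain ⟨e, he⟩ := hG ▸ p.edges_subset_edgeSet h
        rw [← he, hmem] at h
        have h0 : x (a e) = x (b e) := CharTwo.add_eq_zero.1 ((hx e).symm.trans (hd e h))
        obtain ⟨rfl, rfl⟩ | ⟨rfl, rfl⟩ := Sym2.eq_iff.1 he
        exacts [h0, h0.symm]) w (hp.mem_support w)
    funext e
    rw [hx, hconst (a e), hconst (b e), CharTwo.add_self_eq_zero, Pi.zero_apply]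
  set m : ZMod 2 → ℕ := fun i ↦ (Finset.univ.filter fun e ↦ c e = 0 ∧ s (l e) = i).card with hm
  set n : ZMod 2 → ℕ := fun i ↦ (Finset.univ.filter fun f ↦ s f = i).card with hn
  have hle : ∀ i, m i + 1 ≤ n i := fun i ↦ by
    have := card_add_one_le_of_boundary_injOn l r (fun e ↦ c e = 0 ∧ s (l e) = i) (fun f ↦ s f = i)
      (fun e he ↦ he.2) (fun e he ↦ heq e he.1 ▸ he.2) (hsurj i) fun d hd ↦
        hforest d fun e he ↦ hd e (by simp [he])
    rwa [Fintype.card_subtype, Fintype.card_subtype] at this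
  have hsplit : ∀ x : ZMod 2, ((if x = 0 then 1 else 0) + if x = 1 then 1 else 0) = 1 := by decide
  have hn2 : n 0 + n 1 = Fintype.card F := by
    simp only [hn, Finset.card_filter, ← Finset.sum_add_distrib, hsplit]
    simp
  have hm2 : m 0 + m 1 + Fintype.card V = Fintype.card E := by
    rw [← hcard]
    simp only [hm, Finset.card_filter, ← Finset.sum_add_distrib]
    rw [← Finset.card_univ, Finset.card_eq_sum_ones]
    refine Finset.sum_congr rfl fun e _ ↦ ?_
    obtain h | h := hc01 e
    · simpa [h] using hsplit (s (l e))
    · simp [h]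
  have hmn : ∀ i, m i + 1 = n i := by
    have h0 := hle 0
    have h1 := hle 1
    have : ∀ i : ZMod 2, i = 0 ∨ i = 1 := by decide
    intro i
    obtain rfl | rfl := this i <;> omega
  refine ⟨s, fun i ↦ ?_⟩
  have hsum : (∑ f with s f = i, ∑ e, ((if l e = f then 1 else 0) + if r e = f then 1 else 0)) =
      Fintype.card V + 2 * m i := by
    rw [Finset.sum_comm, ← hcard]
    simp only [hm, Finset.card_filter, Finset.mul_sum, ← Finset.sum_add_distrib]
    refine Finset.sum_congr rfl fun e _ ↦ ?_
    rw [Finset.sum_add_distrib]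
    simp only [Finset.sum_ite_eq, Finset.mem_filter, Finset.mem_univ, true_and]
    obtain h | h := hc01 e
    · simp only [h, ← heq e h, true_and, zero_ne_one, if_false]
      split_ifs <;> rfl
    · have h2 : ∀ x y i : ZMod 2, x + y = 1 →
          ((if x = i then 1 else 0) + if y = i then 1 else 0) = 1 := by decide
      simpa [h] using h2 _ _ i ((hs e).symm.trans h)
  have : m i + 1 = (Finset.univ.filter fun f ↦ s f = i).card := hmn i
  omega

/-- Twice the signed area of the triangle `p q r`. -/
def cross {R : Type*} [CommRing R] (p q r : R × R) : R :=
  (q.1 - p.1) * (r.2 - p.2) - (q.2 - p.2) * (r.1 - p.1)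

lemma cross_lineMap (p q r s : ℝ × ℝ) (t : ℝ) :
    cross p q (AffineMap.lineMap r s t) = (1 - t) * cross p q r + t * cross p q s := by
  simp [cross, AffineMap.lineMap_apply]
  ring

lemma cross_eq_zero_of_mem_segment {p q z : ℝ × ℝ} (hz : z ∈ segment ℝ p q) : cross p q z = 0 := by
  rw [segment_eq_image_lineMap] at hz
  obtain ⟨t, -, rfl⟩ := hz
  rw [cross_lineMap]
  simp only [cross]
  ring

/-- A segment lying weakly on one side of a line meets that line in one of its endpoints. -/
lemma eq_endpoint_of_mem_segment {p q r s z : ℝ × ℝ} (h : 0 ≤ cross p q r * cross p q s)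
    (hne : cross p q r ≠ 0 ∨ cross p q s ≠ 0) (hz : z ∈ segment ℝ r s) (hz0 : cross p q z = 0) :
    cross p q r = 0 ∧ z = r ∨ cross p q s = 0 ∧ z = s := by
  rw [segment_eq_image_lineMap] at hz
  obtain ⟨t, ⟨ht0, ht1⟩, rfl⟩ := hz
  rw [cross_lineMap] at hz0
  by_cases hr : cross p q r = 0
  · have hs : cross p q s ≠ 0 := hne.resolve_left (not_not.2 hr)
    have ht : t = 0 := by simpa [hr, hs] using hz0
    exact .inl ⟨hr, by simp [ht]⟩
  · have h1 : (1 - t) * cross p q r ^ 2 = 0 := by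
      have h2 : (1 - t) * cross p q r ^ 2 + t * (cross p q r * cross p q s) = 0 := by
        linear_combination cross p q r * hz0
      have h3 := mul_nonneg (sub_nonneg.2 ht1) (sq_nonneg (cross p q r))
      have h4 := mul_nonneg ht0 h
      linarith
    have ht : t = 1 := by
      have := (mul_eq_zero.1 h1).resolve_right (pow_ne_zero 2 hr)
      linarith
    subst ht
    exact .inr ⟨by simpa using hz0, by simp⟩

/-- A graph is planar if it has a straight-line drawing on the integer grid in which no vertex lies
on the line through an edge it is not on, and in which, of any two edges, one lies weakly on one
side of the line through the other. -/
theorem isPlanar_of_straightLine {G : SimpleGraph V} {a b : E → V}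
    (hG : G.edgeSet = Set.range fun e ↦ s(a e, b e)) (pos : V → ℤ × ℤ)
    (hpos : Function.Injective pos)
    (hvertex : ∀ e v, v ≠ a e → v ≠ b e → cross (pos (a e)) (pos (b e)) (pos v) ≠ 0)
    (hedge : ∀ e f,
      0 ≤ cross (pos (a e)) (pos (b e)) (pos (a f)) * cross (pos (a e)) (pos (b e)) (pos (b f)) ∨
      0 ≤ cross (pos (a f)) (pos (b f)) (pos (a e)) * cross (pos (a f)) (pos (b f)) (pos (b e))) :
    G.IsPlanar := by
  let P : V → ℝ × ℝ := fun v ↦ ((pos v).1, (pos v).2)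
  have hP : Function.Injective P := fun u v h ↦ hpos (by simpa [P, Prod.ext_iff] using h)
  have hcast : ∀ u v w, cross (P u) (P v) (P w) = (cross (pos u) (pos v) (pos w) : ℤ) :=
    fun u v w ↦ by simp [cross, P]
  have harc : ∀ u v, convexHull ℝ (P '' {w | w ∈ s(u, v)}) = segment ℝ (P u) (P v) := fun u v ↦ by
    rw [← convexHull_pair, ← Set.image_pair]
    congr 2
    ext w
    simp
  have hne : ∀ e, a e ≠ b e := fun e ↦
    G.ne_of_adj (show s(a e, b e) ∈ G.edgeSet from hG ▸ ⟨e, rfl⟩)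
  have hmem : ∀ e v, cross (P (a e)) (P (b e)) (P v) = 0 → v ∈ s(a e, b e) := by
    intro e v h
    rw [hcast, Int.cast_eq_zero] at h
    by_contra hv
    rw [Sym2.mem_iff, not_or] at hv
    exact hvertex e v hv.1 hv.2 h
  have hinter : ∀ e f, s(a e, b e) ≠ s(a f, b f) →
      0 ≤ cross (pos (a e)) (pos (b e)) (pos (a f)) * cross (pos (a e)) (pos (b e)) (pos (b f)) →
      ∀ z, z ∈ segment ℝ (P (a e)) (P (b e)) → z ∈ segment ℝ (P (a f)) (P (b f)) →
        ∃ v, v ∈ s(a e, b e) ∧ v ∈ s(a f, b f) ∧ z = P v := by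
    intro e f hef h z hze hzf
    have h' : 0 ≤ cross (P (a e)) (P (b e)) (P (a f)) * cross (P (a e)) (P (b e)) (P (b f)) := by
      rw [hcast, hcast]
      exact_mod_cast h
    have hne' : cross (P (a e)) (P (b e)) (P (a f)) ≠ 0 ∨
        cross (P (a e)) (P (b e)) (P (b f)) ≠ 0 := by
      by_contra! h0
      exact hef ((Sym2.mem_and_mem_iff (hne f)).1 ⟨hmem _ _ h0.1, hmem _ _ h0.2⟩)
    obtain ⟨h0, rfl⟩ | ⟨h0, rfl⟩ :=
      eq_endpoint_of_mem_segment h' hne' hzf (cross_eq_zero_of_mem_segment hze)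
    · exact ⟨a f, hmem _ _ h0, by simp, rfl⟩
    · exact ⟨b f, hmem _ _ h0, by simp, rfl⟩
  refine ⟨⟨P, hP, fun e ↦ convexHull ℝ (P '' {w | w ∈ e}), ?_, ?_, ?_⟩⟩
  · rintro e he u v rfl
    have huv : P u ≠ P v := hP.ne (G.ne_of_adj he)
    refine ⟨AffineMap.lineMap (P u) (P v), AffineMap.lineMap_continuous.continuousOn,
      (AffineMap.lineMap_injective ℝ huv).injOn, ?_, by simp, by simp⟩
    rw [harc, segment_eq_image_lineMap]
  · rintro _ he _ hf hef z ⟨hze, hzf⟩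
    obtain ⟨e, rfl⟩ := hG ▸ he
    obtain ⟨f, rfl⟩ := hG ▸ hf
    simp only [harc] at hze hzf
    obtain h | h := hedge e f
    · exact hinter e f hef h z hze hzf
    · obtain ⟨v, hvf, hve, rfl⟩ := hinter f e hef.symm h z hzf hze
      exact ⟨v, hve, hvf, rfl⟩
  · rintro _ he v hv
    obtain ⟨e, rfl⟩ := hG ▸ he
    simp only [harc] at hv
    exact hmem e v (cross_eq_zero_of_mem_segment hv)

/-- A bijective enumeration of the vertices along which cyclically consecutive vertices are adjacent
gives a Hamiltonian cycle. -/
lemma isHamiltonian_of_bijective [Fintype V] [DecidableEq V] {G : SimpleGraph V} {n : ℕ}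
    (f : Fin (n + 3) → V) (hf : Function.Bijective f) (hadj : ∀ i, G.Adj (f i) (f (i + 1))) :
    G.IsHamiltonian := by
  let φ : cycleGraph (n + 3) →g G := ⟨f, fun {i j} hij ↦ by
    obtain h | h := cycleGraph_adj.1 hij
    · rw [sub_eq_iff_eq_add'.1 h]
      exact (hadj j).symm
    · rw [sub_eq_iff_eq_add'.1 h]
      exact hadj i⟩
  have hcycle : (cycleGraph.cycle n).IsHamiltonianCycle :=
    Walk.isHamiltonianCycle_iff_isCycle_and_length_eq.2 ⟨cycleGraph.isCycle_cycle, by simp⟩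
  exact fun _ ↦ ⟨_, _, hcycle.map (f := φ) hf⟩

end SimpleGraph

/-! ### A planar hypohamiltonian graph

The graph below has 42 vertices, 67 edges and 27 faces: face `0` is a quadrilateral and all the
others are pentagons. It has a half-turn symmetry exchanging the vertices `v` and `v + 21`. -/

namespace PlanarHypohamiltonian

/-- The two ends of each edge. -/
def ends : Fin 67 → Fin 42 × Fin 42 :=
  List.get [
    (0, 1), (0, 12), (0, 21), (1, 2), (1, 3), (1, 4), (2, 5), (2, 7), (3, 6), (3, 10), (4, 16),
    (4, 33), (5, 6), (5, 8), (6, 9), (7, 12), (7, 13), (8, 11), (8, 13), (9, 11), (9, 14),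
    (10, 14), (10, 16), (11, 15), (12, 20), (12, 25), (13, 18), (14, 17), (15, 17), (15, 18),
    (16, 19), (17, 19), (18, 20), (19, 20), (19, 41), (20, 40), (21, 22), (21, 33), (22, 23),
    (22, 24), (22, 25), (23, 26), (23, 28), (24, 27), (24, 31), (25, 37), (26, 27), (26, 29),
    (27, 30), (28, 33), (28, 34), (29, 32), (29, 34), (30, 32), (30, 35), (31, 35), (31, 37),
    (32, 36), (33, 41), (34, 39), (35, 38), (36, 38), (36, 39), (37, 40), (38, 40), (39, 41),
    (40, 41)]

/-- The two faces on the sides of each edge. -/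
def sides : Fin 67 → Fin 27 × Fin 27 :=
  List.get [
    (8, 22), (5, 22), (5, 8), (1, 22), (1, 7), (7, 8), (1, 24), (22, 24), (1, 2), (2, 7),
    (7, 13), (8, 13), (1, 10), (10, 24), (2, 10), (22, 23), (23, 24), (10, 25), (24, 25),
    (9, 10), (2, 9), (2, 12), (7, 12), (9, 25), (21, 23), (5, 21), (23, 25), (9, 12), (9, 20),
    (20, 25), (12, 13), (12, 20), (20, 23), (0, 20), (0, 13), (0, 21), (5, 6), (6, 8), (3, 6),
    (3, 16), (5, 16), (3, 15), (6, 15), (3, 26), (16, 26), (16, 21), (3, 4), (4, 15), (4, 26),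
    (6, 14), (14, 15), (4, 11), (11, 15), (4, 18), (18, 26), (17, 26), (16, 17), (11, 18),
    (13, 14), (11, 14), (17, 18), (18, 19), (11, 19), (17, 21), (17, 19), (14, 19), (0, 19)]

/-- The positions of the vertices in a straight-line drawing. -/
def position : Fin 42 → ℤ × ℤ :=
  List.get [
    (5, -11), (15, 2), (17, -13), (26, 3), (16, 23), (25, -13), (29, -6), (15, -27), (27, -22),
    (36, -7), (36, 9), (34, -16), (6, -38), (24, -32), (42, 0), (40, -21), (42, 19), (52, 1),
    (28, -44), (67, 21), (21, -67), (-5, 11), (-15, -2), (-17, 13), (-26, -3), (-16, -23),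
    (-25, 13), (-29, 6), (-15, 27), (-27, 22), (-36, 7), (-36, -9), (-34, 16), (-6, 38),
    (-24, 32), (-42, 0), (-40, 21), (-42, -19), (-52, -1), (-28, 44), (-67, -21), (-21, 67)]

/-- For each vertex, the bit mask of the edges on the path to it from vertex `0` in a fixed spanning
tree. -/
def treePath : Fin 42 → ℕ :=
  List.get [
    0x0, 0x1, 0x9, 0x11, 0x21, 0x49, 0x111, 0x8002, 0x2049, 0x4111, 0x211, 0x22049, 0x2,
    0x18002, 0x200211, 0x121000002, 0x421, 0x281000002, 0x101000002, 0x201000002, 0x1000002,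
    0x4, 0x1000000004, 0x5000000004, 0x9000000004, 0x2000002, 0x25000000004, 0x89000000004,
    0x2002000000004, 0x825000000004, 0x1089000000004, 0x100200002000002, 0x12200000801000002,
    0x2000000004, 0x6002000000004, 0x11000000801000002, 0x12000000801000002, 0x200002000002,
    0x10000000801000002, 0x20400002000000004, 0x801000002, 0x400002000000004]

/-- For each face, the bit mask of the edges crossed on the way to it from face `0` in the spanning
tree of the dual graph formed by the edges outside the fixed spanning tree. -/
def dualTreePath : Fin 27 → ℕ :=
  List.get [
    0x0, 0x448081000, 0x448100000, 0x44008400000000000, 0x44008000000000000,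
    0x44068110000000000, 0x44010040000000000, 0x440400000, 0x400000800, 0x448000000,
    0x448080000, 0x44000000000000000, 0x440000000, 0x400000000, 0x44800000000000000,
    0x44010000000000000, 0x44068100000000000, 0x440e8000000000000, 0x44028000000000000,
    0x40000000000000000, 0x458000000, 0x4c0e8000000000000, 0x448840080, 0x44c800000,
    0x448840000, 0x448800000, 0x44068000000000000]

/-- Hamiltonian cycles of the graphs obtained by deleting one of the vertices `0, …, 20`. -/
def cycleTable : List (List ℕ) := [
    [1, 2, 5, 6, 3, 10, 14, 9, 11, 8, 13, 7, 12, 25, 37, 31, 24, 22, 21, 33, 28, 23, 26, 27, 30,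
     35, 38, 36, 32, 29, 34, 39, 41, 40, 20, 18, 15, 17, 19, 16, 4],
    [0, 21, 22, 23, 26, 27, 24, 31, 35, 30, 32, 29, 34, 28, 33, 4, 16, 10, 3, 6, 5, 2, 7, 13, 8,
     11, 9, 14, 17, 15, 18, 20, 19, 41, 39, 36, 38, 40, 37, 25, 12],
    [0, 1, 3, 6, 5, 8, 11, 9, 14, 10, 16, 4, 33, 21, 22, 25, 37, 31, 24, 27, 26, 23, 28, 34, 29,
     32, 30, 35, 38, 36, 39, 41, 40, 20, 19, 17, 15, 18, 13, 7, 12],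
    [0, 1, 2, 5, 6, 9, 11, 8, 13, 7, 12, 25, 37, 31, 24, 22, 23, 28, 34, 39, 36, 32, 29, 26, 27,
     30, 35, 38, 40, 41, 19, 20, 18, 15, 17, 14, 10, 16, 4, 33, 21],
    [0, 1, 2, 5, 6, 3, 10, 16, 19, 20, 18, 15, 17, 14, 9, 11, 8, 13, 7, 12, 25, 37, 31, 24, 22,
     23, 26, 27, 30, 35, 38, 40, 41, 39, 36, 32, 29, 34, 28, 33, 21],
    [0, 21, 22, 23, 26, 27, 24, 31, 35, 30, 32, 29, 34, 28, 33, 4, 16, 10, 3, 6, 9, 14, 17, 15,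
     11, 8, 13, 18, 20, 19, 41, 39, 36, 38, 40, 37, 25, 12, 7, 2, 1],
    [0, 21, 22, 23, 26, 27, 24, 31, 37, 25, 12, 7, 2, 5, 8, 13, 18, 15, 11, 9, 14, 17, 19, 20,
     40, 41, 39, 36, 38, 35, 30, 32, 29, 34, 28, 33, 4, 16, 10, 3, 1],
    [0, 12, 25, 37, 31, 24, 22, 23, 28, 34, 39, 36, 32, 29, 26, 27, 30, 35, 38, 40, 41, 19, 20,
     18, 13, 8, 5, 2, 1, 3, 6, 9, 11, 15, 17, 14, 10, 16, 4, 33, 21],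
    [0, 21, 22, 23, 26, 27, 24, 31, 35, 30, 32, 29, 34, 28, 33, 4, 16, 10, 14, 9, 11, 15, 17,
     19, 41, 39, 36, 38, 40, 37, 25, 12, 20, 18, 13, 7, 2, 5, 6, 3, 1],
    [0, 21, 22, 23, 26, 27, 24, 31, 35, 30, 32, 29, 34, 28, 33, 4, 16, 10, 14, 17, 15, 11, 8, 5,
     6, 3, 1, 2, 7, 13, 18, 20, 19, 41, 39, 36, 38, 40, 37, 25, 12],
    [0, 21, 22, 23, 26, 27, 24, 31, 35, 30, 32, 29, 34, 28, 33, 4, 16, 19, 41, 39, 36, 38, 40,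
     37, 25, 12, 20, 18, 13, 7, 2, 5, 8, 11, 15, 17, 14, 9, 6, 3, 1],
    [0, 21, 22, 23, 26, 27, 24, 31, 35, 30, 32, 29, 34, 28, 33, 4, 16, 10, 3, 1, 2, 7, 13, 8, 5,
     6, 9, 14, 17, 15, 18, 20, 19, 41, 39, 36, 38, 40, 37, 25, 12],
    [0, 21, 22, 25, 37, 40, 38, 35, 31, 24, 27, 30, 32, 36, 39, 34, 29, 26, 23, 28, 33, 41, 19,
     20, 18, 13, 7, 2, 5, 8, 11, 15, 17, 14, 9, 6, 3, 10, 16, 4, 1],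
    [0, 21, 22, 23, 26, 27, 24, 31, 35, 30, 32, 29, 34, 28, 33, 4, 16, 10, 3, 6, 5, 8, 11, 9,
     14, 17, 15, 18, 20, 19, 41, 39, 36, 38, 40, 37, 25, 12, 7, 2, 1],
    [0, 21, 22, 23, 26, 27, 24, 31, 35, 30, 32, 29, 34, 28, 33, 41, 39, 36, 38, 40, 37, 25, 12,
     7, 2, 5, 8, 13, 18, 20, 19, 17, 15, 11, 9, 6, 3, 10, 16, 4, 1],
    [0, 21, 22, 23, 26, 27, 24, 31, 35, 30, 32, 29, 34, 28, 33, 4, 16, 10, 3, 6, 5, 8, 11, 9,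
     14, 17, 19, 41, 39, 36, 38, 40, 37, 25, 12, 20, 18, 13, 7, 2, 1],
    [0, 21, 22, 23, 26, 27, 24, 31, 37, 25, 12, 7, 2, 5, 6, 3, 10, 14, 9, 11, 8, 13, 18, 15, 17,
     19, 20, 40, 41, 39, 36, 38, 35, 30, 32, 29, 34, 28, 33, 4, 1],
    [0, 21, 22, 23, 26, 27, 24, 31, 35, 30, 32, 29, 34, 28, 33, 4, 16, 19, 41, 39, 36, 38, 40,
     37, 25, 12, 20, 18, 15, 11, 8, 13, 7, 2, 5, 6, 9, 14, 10, 3, 1],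
    [0, 21, 22, 23, 26, 27, 24, 31, 37, 25, 12, 20, 40, 41, 39, 36, 38, 35, 30, 32, 29, 34, 28,
     33, 4, 16, 19, 17, 15, 11, 8, 13, 7, 2, 5, 6, 9, 14, 10, 3, 1],
    [0, 21, 22, 23, 26, 27, 24, 31, 35, 30, 32, 29, 34, 28, 33, 41, 39, 36, 38, 40, 37, 25, 12,
     20, 18, 13, 7, 2, 5, 8, 11, 15, 17, 14, 9, 6, 3, 10, 16, 4, 1],
    [0, 12, 7, 2, 1, 4, 16, 10, 3, 6, 5, 8, 13, 18, 15, 11, 9, 14, 17, 19, 41, 33, 28, 23, 26,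
     27, 24, 31, 35, 30, 32, 29, 34, 39, 36, 38, 40, 37, 25, 22, 21]]

/-- A Hamiltonian cycle of the graph with `v` deleted. -/
def cycleAvoiding (v : Fin 42) (i : Fin 41) : Fin 42 :=
  Fin.ofNat 42 (((cycleTable.getD (v % 21) []).getD i 0) + 21 * (v / 21))

/-- The graph with edges `ends`. -/
def graph : SimpleGraph (Fin 42) :=
  SimpleGraph.fromEdgeSet (Set.range fun e ↦ s((ends e).1, (ends e).2))

lemma fst_ends_lt_snd_ends (e : Fin 67) : (ends e).1 < (ends e).2 := by
  revert e
  decide +kernel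

lemma edgeSet_graph : graph.edgeSet = Set.range fun e ↦ s((ends e).1, (ends e).2) := by
  rw [graph, SimpleGraph.edgeSet_fromEdgeSet, sdiff_eq_left, Set.disjoint_left]
  rintro _ ⟨e, rfl⟩ h
  exact (fst_ends_lt_snd_ends e).ne h

lemma ends_injective : Function.Injective fun e ↦ s((ends e).1, (ends e).2) := by
  have h : ∀ e f, ends e = ends f → e = f := by decide +kernel
  intro e f hef
  refine h e f ?_
  have he := fst_ends_lt_snd_ends e
  have hf := fst_ends_lt_snd_ends f
  obtain ⟨h1, h2⟩ | ⟨h1, h2⟩ := Sym2.eq_iff.1 hef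
  · exact Prod.ext h1 h2
  · exact absurd (h1 ▸ h2 ▸ he) hf.asymm

theorem isPlanar_graph : graph.IsPlanar :=
  SimpleGraph.isPlanar_of_straightLine edgeSet_graph position
    (by unfold Function.Injective; decide +kernel) (by decide +kernel) (by decide +kernel)

lemma treePath_dualTreePath (e e' : Fin 67) :
    (if (treePath (ends e').1).testBit e then 1 else 0 : ZMod 2) +
        (if (treePath (ends e').2).testBit e then 1 else 0) +
      ((if (dualTreePath (sides e).1).testBit e' then 1 else 0) +
        if (dualTreePath (sides e).2).testBit e' then 1 else 0) = if e = e' then 1 else 0 := by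
  revert e e'
  decide +kernel

/-- Face `0` is a quadrilateral and the other faces are pentagons. -/
lemma card_sides (f : Fin 27) :
    ∑ e, ((if (sides e).1 = f then 1 else 0) + if (sides e).2 = f then 1 else 0) =
      5 - if f = 0 then 1 else 0 := by
  revert f
  decide +kernel

theorem not_isHamiltonian_graph : ¬ graph.IsHamiltonian := by
  intro h
  obtain ⟨p, hp⟩ := h.exists_isHamiltonianCycle 0
  obtain ⟨s, hs⟩ := hp.grinberg (l := fun e ↦ (sides e).1) (r := fun e ↦ (sides e).2)
    ends_injective edgeSet_graph
    (fun _ ↦ SimpleGraph.exists_potential _ _ _ _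
      (fun v (e : Fin 67) ↦ if (treePath v).testBit e then 1 else 0)
      (fun f (e : Fin 67) ↦ if (dualTreePath f).testBit e then 1 else 0) treePath_dualTreePath)
    (fun _ ↦ SimpleGraph.exists_potential _ _ _ _
      (fun f (e : Fin 67) ↦ if (dualTreePath f).testBit e then 1 else 0)
      (fun v (e : Fin 67) ↦ if (treePath v).testBit e then 1 else 0) fun e e' ↦ by
        rw [add_comm, treePath_dualTreePath]
        simp only [eq_comm]) (by simp)
  have hne : s 0 + 1 ≠ s 0 := by simp
  have h5 : ∀ f ∈ Finset.univ.filter fun f ↦ s f = s 0 + 1,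
      ∑ e, ((if (sides e).1 = f then 1 else 0) + if (sides e).2 = f then 1 else 0) = 5 := by
    intro f hf
    rw [card_sides, if_neg]
    rintro rfl
    exact hne (Finset.mem_filter.1 hf).2.symm
  have h3 := hs (s 0 + 1)
  rw [Finset.sum_congr rfl h5, Finset.sum_const, smul_eq_mul, Fintype.card_fin] at h3
  omega

lemma cycleAvoiding_ne (v : Fin 42) (i : Fin 41) : cycleAvoiding v i ≠ v := by
  revert v i
  decide +kernel

lemma cycleAvoiding_injective (v : Fin 42) : Function.Injective (cycleAvoiding v) := by
  unfold Function.Injective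
  revert v
  decide +kernel

lemma adj_cycleAvoiding (v : Fin 42) (i : Fin 41) :
    graph.Adj (cycleAvoiding v i) (cycleAvoiding v (i + 1)) := by
  have h : ∀ v i, ∃ e, ends e = (cycleAvoiding v i, cycleAvoiding v (i + 1)) ∨
      ends e = (cycleAvoiding v (i + 1), cycleAvoiding v i) := by decide +kernel
  obtain ⟨e, he⟩ := h v i
  rw [← SimpleGraph.mem_edgeSet, edgeSet_graph]
  refine ⟨e, ?_⟩
  obtain he | he := he <;> simp [he, Sym2.eq_swap]

theorem isHamiltonian_induce_ne (v : Fin 42) : (graph.induce {u | u ≠ v}).IsHamiltonian := by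
  obtain ⟨f, hne, hinj, hadj⟩ : ∃ f : Fin (38 + 3) → Fin 42, (∀ i, f i ≠ v) ∧
      Function.Injective f ∧ ∀ i, graph.Adj (f i) (f (i + 1)) :=
    ⟨_, cycleAvoiding_ne v, cycleAvoiding_injective v, adj_cycleAvoiding v⟩
  refine SimpleGraph.isHamiltonian_of_bijective (fun i ↦ ⟨f i, hne i⟩)
    ((Fintype.bijective_iff_injective_and_card _).2
      ⟨fun i j h ↦ hinj (congrArg Subtype.val h), ?_⟩) hadj
  simp [Set.coe_ofPred]

end PlanarHypohamiltonian

/-- There exists a planar hypohamiltonian graph on 42 vertices. -/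
theorem exists_planar_hypohamiltonian_on_42_vertices :
    ∃ G : SimpleGraph (Fin 42), G.IsPlanar ∧ G.IsHypohamiltonian := by
  exact ⟨PlanarHypohamiltonian.graph, PlanarHypohamiltonian.isPlanar_graph,
    PlanarHypohamiltonian.not_isHamiltonian_graph, PlanarHypohamiltonian.isHamiltonian_induce_ne⟩
end

section
/- Grinberg's criterion: if G is a plane graph with a Hamiltonian cycle C, and f_i (respectively g_i) denotes the number of faces of size i inside (respectively outside) C, then the sum over i of (i - 2)(f_i - g_i) equals 0. -/
open SimpleGraph Set

open SimpleGraph Set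

section ContinuousLogarithm

open Complex

/-- `f` admits a continuous logarithm on the set `S`. -/
def HasContLog {X : Type*} [TopologicalSpace X] (f : X → ℂ) (S : Set X) : Prop :=
  ∃ g : X → ℂ, ContinuousOn g S ∧ ∀ x ∈ S, exp (g x) = f x

namespace HasContLog

variable {X : Type*} [TopologicalSpace X] {f f' : X → ℂ} {S T : Set X}

theorem mono (h : HasContLog f S) (hT : T ⊆ S) : HasContLog f T :=
  let ⟨g, hg, he⟩ := h
  ⟨g, hg.mono hT, fun x hx => he x (hT hx)⟩

theorem congr (h : HasContLog f S) (hf : ∀ x ∈ S, f x = f' x) : HasContLog f' S :=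
  let ⟨g, hg, he⟩ := h
  ⟨g, hg, fun x hx => (he x hx).trans (hf x hx)⟩

theorem of_subtype {g : S → ℂ} (hg : Continuous g) (he : ∀ x : S, exp (g x) = f x) :
    HasContLog f S := by
  classical
  refine ⟨fun x => if h : x ∈ S then g ⟨x, h⟩ else 0, ?_, fun x hx => by simp [hx, he ⟨x, hx⟩]⟩
  rw [continuousOn_iff_continuous_domRestrict]
  convert hg using 1
  ext x
  simp

/-- A nonvanishing homotopy transports continuous logarithms from time `0` to time `1`. -/
theorem of_homotopy {F : ℝ → X → ℂ}
    (hF : ContinuousOn (fun q : ℝ × X => F q.1 q.2) (Icc 0 1 ×ˢ S))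
    (h0 : ∀ t ∈ Icc (0 : ℝ) 1, ∀ x ∈ S, F t x ≠ 0) (h : HasContLog (F 0) S) :
    HasContLog (F 1) S := by
  obtain ⟨g, hg, he⟩ := h
  let H : C(unitInterval × S, {z : ℂ // z ≠ 0}) :=
    ⟨fun q => ⟨F q.1 q.2, h0 _ q.1.2 _ q.2.2⟩, by
      refine Continuous.subtype_mk ?_ _
      exact hF.comp_continuous (f := fun q : unitInterval × S => ((q.1 : ℝ), (q.2 : X)))
        (by fun_prop) (fun q => ⟨q.1.2, q.2.2⟩)⟩
  let g' : C(S, ℂ) := ⟨fun x => g x, continuousOn_iff_continuous_domRestrict.1 hg⟩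
  have H0 : ∀ a, H (0, a) = (fun z : ℂ ↦ (⟨_, z.exp_ne_zero⟩ : {z : ℂ // z ≠ 0})) (g' a) := by
    intro a
    apply Subtype.ext
    exact (he a a.2).symm
  have hl := isCoveringMap_exp.liftHomotopy_lifts H g' H0
  refine of_subtype (g := fun x => isCoveringMap_exp.liftHomotopy H g' H0 (1, x)) (by fun_prop)
    fun x => ?_
  simpa [H] using congrArg Subtype.val (congrFun hl (1, x))

theorem const {c : ℂ} (hc : c ≠ 0) : HasContLog (fun _ => c) S :=
  ⟨fun _ => log c, continuousOn_const, fun _ _ => exp_log hc⟩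

/-- Logarithms on two closed sets glue if they agree on the intersection. -/
theorem glue (hS : IsClosed S) (hT : IsClosed T) {g g' : X → ℂ}
    (hg : ContinuousOn g S) (hg' : ContinuousOn g' T)
    (he : ∀ x ∈ S, exp (g x) = f x) (he' : ∀ x ∈ T, exp (g' x) = f x)
    (hgg' : ∀ x ∈ S ∩ T, g x = g' x) : HasContLog f (S ∪ T) := by
  classical
  have e1 : EqOn (fun x => if x ∈ S then g x else g' x) g S := fun x hx => by simp [hx]
  have e2 : EqOn (fun x => if x ∈ S then g x else g' x) g' T := fun x hx => by
    by_cases h : x ∈ S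
    · simp [h, hgg' x ⟨h, hx⟩]
    · simp [h]
  refine ⟨fun x => if x ∈ S then g x else g' x, ?_, ?_⟩
  · exact (hg.congr e1).union_of_isClosed (hg'.congr e2) hS hT
  · rintro x (hx | hx)
    · rw [e1 hx, he x hx]
    · rw [e2 hx, he' x hx]

/-- Logarithms on two closed sets that share at most one point glue after a shift. -/
theorem union_of_inter_singleton (hS : IsClosed S) (hT : IsClosed T) {x₀ : X}
    (hST : S ∩ T ⊆ {x₀}) (h : HasContLog f S) (h' : HasContLog f T) :
    HasContLog f (S ∪ T) := by
  obtain ⟨g, hg, he⟩ := h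
  obtain ⟨g', hg', he'⟩ := h'
  by_cases hx₀ : x₀ ∈ S ∩ T
  · refine glue hS hT hg (hg'.add (continuousOn_const (c := g x₀ - g' x₀))) he ?_ ?_
    · intro x hx
      simp only [Pi.add_apply]
      rw [exp_add, exp_sub, he' x hx, he x₀ hx₀.1, he' x₀ hx₀.2, div_self, mul_one]
      rw [← he x₀ hx₀.1]
      exact exp_ne_zero _
    · intro x hx
      obtain rfl : x = x₀ := hST hx
      simp
  · refine glue hS hT hg hg' he he' fun x hx => ?_
    obtain rfl : x = x₀ := hST hx
    exact absurd hx hx₀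

/-- The image of an injective path carries no nontrivial winding. -/
theorem of_arc [T2Space X] {γ : ℝ → X} (hγ : ContinuousOn γ (Icc 0 1))
    (hi : InjOn γ (Icc 0 1)) (hf : ContinuousOn f (γ '' Icc 0 1))
    (h0 : ∀ x ∈ γ '' Icc 0 1, f x ≠ 0) : HasContLog f (γ '' Icc 0 1) := by
  have hlog : HasContLog (fun s => f (γ (1 * s))) (Icc (0 : ℝ) 1) := by
    have hm : ∀ t ∈ Icc (0 : ℝ) 1, ∀ s ∈ Icc (0 : ℝ) 1, t * s ∈ Icc (0 : ℝ) 1 := fun t ht s hs =>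
      ⟨mul_nonneg ht.1 hs.1, mul_le_one₀ ht.2 hs.1 hs.2⟩
    refine of_homotopy (F := fun t s => f (γ (t * s))) ?_ ?_ ?_
    · refine hf.comp (hγ.comp (by fun_prop) ?_) ?_
      · exact fun q hq => hm _ hq.1 _ hq.2
      · exact fun q hq => mem_image_of_mem _ (hm _ hq.1 _ hq.2)
    · exact fun t ht s hs => h0 _ (mem_image_of_mem _ (hm _ ht _ hs))
    · have : f (γ 0) ≠ 0 := h0 _ (mem_image_of_mem _ (by simp))
      simpa using const (S := Icc (0 : ℝ) 1) this
  obtain ⟨g, hg, he⟩ := hlog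
  have hemb : Topology.IsClosedEmbedding (fun t : Icc (0 : ℝ) 1 => γ t) :=
    Continuous.isClosedEmbedding (continuousOn_iff_continuous_domRestrict.1 hγ)
      (fun a b hab => Subtype.ext (hi a.2 b.2 hab))
  let φ := hemb.isEmbedding.toHomeomorph
  have hr : ∀ x : γ '' Icc 0 1, (x : X) ∈ range (fun t : Icc (0 : ℝ) 1 => γ t) := by
    rintro ⟨_, t, ht, rfl⟩
    exact ⟨⟨t, ht⟩, rfl⟩
  refine of_subtype (g := fun x => g (φ.symm ⟨x, hr x⟩)) ?_ ?_
  · exact (continuousOn_iff_continuous_domRestrict.1 hg).comp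
      (φ.symm.continuous.comp (by fun_prop))
  · intro x
    refine (he _ (φ.symm ⟨x, hr x⟩).2).trans ?_
    simp only [one_mul]
    congr 1
    exact congrArg Subtype.val (φ.apply_symm_apply ⟨x, hr x⟩)

end HasContLog

end ContinuousLogarithm
section PlaneTopology

open Complex Topology

/-- A continuous function with constant exponential is constant on preconnected sets. -/
theorem IsPreconnected.eq_of_exp_eq {X : Type*} [TopologicalSpace X] {T : Set X}
    (hT : IsPreconnected T) {k : X → ℂ} (hk : ContinuousOn k T) {c : ℂ}
    (he : ∀ x ∈ T, exp (k x) = c) {x y : X} (hx : x ∈ T) (hy : y ∈ T) : k x = k y :=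
  (isCoveringMap_exp.eqOn_of_comp_eqOn hT hk (continuousOn_const (c := k y))
    (fun z hz => Subtype.ext ((he z hz).trans (he y hy).symm)) hy rfl) hx

/-- The displacement from `p` to `z`, as a complex number. -/
noncomputable def disp (p z : ℝ × ℝ) : ℂ := equivRealProdCLM.symm (z - p)

@[fun_prop]
theorem continuousOn_disp {X : Type*} [TopologicalSpace X] {f g : X → ℝ × ℝ} {S : Set X}
    (hf : ContinuousOn f S) (hg : ContinuousOn g S) :
    ContinuousOn (fun x => disp (f x) (g x)) S :=
  equivRealProdCLM.symm.continuous.comp_continuousOn (hg.sub hf)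

theorem disp_eq_zero {p z : ℝ × ℝ} : disp p z = 0 ↔ z = p := by
  simp [disp, sub_eq_zero]

theorem disp_ne_zero {p z : ℝ × ℝ} (h : z ≠ p) : disp p z ≠ 0 := mt disp_eq_zero.1 h

theorem disp_add_equivRealProdCLM (p : ℝ × ℝ) (w : ℂ) :
    disp p (p + equivRealProdCLM w) = w := by
  rw [disp, add_sub_cancel_left, ContinuousLinearEquiv.symm_apply_apply]

theorem norm_sub_le_norm_disp (p z : ℝ × ℝ) : ‖z - p‖ ≤ ‖disp p z‖ := by
  have : z - p = equivRealProd (disp p z) :=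
    (equivRealProdCLM.apply_symm_apply (z - p)).symm
  rw [this]
  exact equivRealProd_apply_le _

/-- Points joined outside of `S` have the same winding behaviour on `S`. -/
theorem hasContLog_disp_div_of_joinedIn {S T : Set (ℝ × ℝ)} {p q : ℝ × ℝ} (h : JoinedIn T p q)
    (hST : Disjoint S T) : HasContLog (fun z => disp q z / disp p z) S := by
  obtain ⟨γ, hγ⟩ := h
  have hT : ∀ t, γ.extend t ∈ T := fun t => hγ _
  have hne : ∀ t, ∀ z ∈ S, disp (γ.extend t) z ≠ 0 := fun t z hz =>
    disp_ne_zero fun e => disjoint_left.1 hST hz (e ▸ hT t)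
  have h0 : ∀ z ∈ S, disp p z ≠ 0 := by simpa using hne 0
  have := HasContLog.of_homotopy (S := S) (F := fun t z => disp (γ.extend t) z / disp p z)
    (ContinuousOn.div (by fun_prop) (by fun_prop) fun q hq => h0 _ hq.2)
    (fun t _ z hz => div_ne_zero (hne t z hz) (h0 z hz))
    ((HasContLog.const one_ne_zero).congr fun z hz => by simp [div_self (h0 z hz)])
  simpa using this

theorem eq_zero_of_hasContLog_circle {p : ℝ × ℝ} {n : ℤ} {R : ℝ} (hR : 0 < R)
    (h : HasContLog (fun z => disp p z ^ n) {z | ‖disp p z‖ = R}) : n = 0 := by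
  obtain ⟨g, hg, he⟩ := h
  let ζ : ℝ → ℝ × ℝ := fun θ => p + equivRealProdCLM (R * exp (θ * I))
  have hζ : Continuous ζ := by fun_prop
  have hd : ∀ θ, disp p (ζ θ) = R * exp (θ * I) := fun θ => disp_add_equivRealProdCLM _ _
  have hm : ∀ θ, ζ θ ∈ {z | ‖disp p z‖ = R} := fun θ => by
    simp [hd, norm_exp_ofReal_mul_I, abs_of_pos hR]
  have key := isPreconnected_univ.eq_of_exp_eq (T := (univ : Set ℝ))
    (k := fun θ => g (ζ θ) - n * (θ * I)) (c := (R : ℂ) ^ n)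
    ((hg.comp_continuous hζ hm).sub (by fun_prop)).continuousOn
    (fun θ _ => by
      simp only [exp_sub, he _ (hm θ), hd]
      rw [mul_zpow, ← exp_int_mul, mul_div_cancel_right₀ _ (exp_ne_zero _)])
    (mem_univ (2 * Real.pi)) (mem_univ 0)
  have hper : ζ (2 * Real.pi) = ζ 0 := by simp [ζ]
  simp only [hper, ofReal_zero, zero_mul, mul_zero, sub_zero, sub_eq_self] at key
  simpa [Real.pi_ne_zero] using key

theorem hasContLog_univ {F : ℝ × ℝ → ℂ} (hF : Continuous F) (h0 : ∀ z, F z ≠ 0) :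
    HasContLog F univ := by
  have := HasContLog.of_homotopy (S := univ) (F := fun t z => F (t • z))
    (by fun_prop) (fun t _ z _ => h0 _) (by simpa using HasContLog.const (h0 0))
  simpa using this

theorem exists_forall_norm_disp_lt {S : Set (ℝ × ℝ)} (hS : Bornology.IsBounded S) (p : ℝ × ℝ) :
    ∃ R > 0, ∀ z ∈ S, ‖disp p z‖ < R := by
  obtain ⟨R, hR⟩ := ((hS.isCompact_closure).image_of_continuousOn
    (f := fun z => ‖disp p z‖) (by fun_prop)).isBounded.bddAbove
  refine ⟨max R 0 + 1, by positivity, fun z hz => ?_⟩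
  have h1 : ‖disp p z‖ ≤ R := hR (mem_image_of_mem _ (subset_closure hz))
  have h2 := le_max_left R 0
  linarith

/-- A point `p` of a bounded open set `U` has nonzero winding on the frontier of `U`, even after
multiplication by a function that does not vanish on the closure of `U`. -/
theorem eq_zero_of_hasContLog_frontier {U : Set (ℝ × ℝ)} (hU : IsOpen U)
    (hb : Bornology.IsBounded U) {p : ℝ × ℝ} (hp : p ∈ U) {Φ : ℝ × ℝ → ℂ}
    (hΦ : ContinuousOn Φ (closure U)) (hΦ0 : ∀ z ∈ closure U, Φ z ≠ 0) {n : ℤ}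
    (h : HasContLog (fun z => disp p z ^ n * Φ z) (frontier U)) : n = 0 := by
  classical
  obtain ⟨g, hg, he⟩ := h
  obtain ⟨G, hG⟩ := ContinuousMap.exists_restrict_eq (isClosed_frontier (s := U))
    ⟨_, continuousOn_iff_continuous_domRestrict.1 hg⟩
  have hG' : ∀ z ∈ frontier U, G z = g z := fun z hz => by
    simpa using DFunLike.congr_fun hG ⟨z, hz⟩
  have hpc : ∀ z ∈ closure {z | ¬ z ∈ closure U}, z ≠ p := by
    rintro z hz rfl
    obtain ⟨w, hw', hw⟩ := mem_closure_iff.1 hz U hU hp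
    exact hw (subset_closure hw')
  have hFc : Continuous fun z => if z ∈ closure U then exp (G z) / Φ z else disp p z ^ n := by
    refine continuous_if (fun z hz => ?_) ?_ ?_
    · have hz' : z ∈ frontier U := frontier_closure_subset hz
      rw [hG' z hz', he z hz', mul_div_cancel_right₀ _ (hΦ0 z hz'.1)]
    · change ContinuousOn _ (closure (closure U))
      rw [closure_closure]
      exact ContinuousOn.div (by fun_prop) hΦ hΦ0
    · exact ContinuousOn.zpow₀ (by fun_prop) _ fun z hz => Or.inl (disp_ne_zero (hpc z hz))
  have hF0 : ∀ z, (if z ∈ closure U then exp (G z) / Φ z else disp p z ^ n) ≠ 0 := by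
    intro z
    split_ifs with hz
    · exact div_ne_zero (exp_ne_zero _) (hΦ0 z hz)
    · exact zpow_ne_zero _ (disp_ne_zero fun e => hz (e ▸ subset_closure hp))
  obtain ⟨R, hR0, hR⟩ := exists_forall_norm_disp_lt hb.closure p
  refine eq_zero_of_hasContLog_circle hR0 (((hasContLog_univ hFc hF0).mono (subset_univ _)).congr
    fun z hz => if_neg fun hz' => ?_)
  exact (hR z hz').ne hz

/-- The exterior of a large disc is connected. -/
theorem isPreconnected_setOf_lt_norm_disp {R : ℝ} (hR : 0 < R) :
    IsPreconnected {z : ℝ × ℝ | R < ‖disp 0 z‖} := by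
  have h1 : IsPreconnected {w : ℂ | Real.log R < w.re} :=
    (convex_halfSpace_re_gt _).isPreconnected
  convert! h1.image (fun w => equivRealProdCLM (exp w)) (by fun_prop) using 1
  ext z
  constructor
  · intro hz
    have h0 : disp 0 z ≠ 0 := norm_pos_iff.1 (hR.trans hz)
    refine ⟨log (disp 0 z), ?_, ?_⟩
    · simpa [log_re] using Real.log_lt_log hR hz
    · simp only [exp_log h0]
      simp [disp]
  · rintro ⟨w, hw, rfl⟩
    have := disp_add_equivRealProdCLM 0 (exp w)
    rw [zero_add] at this
    simp only [mem_ofPred_eq, this, norm_exp]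
    exact (Real.log_lt_iff_lt_exp hR).1 hw

/-- `F` is a connected component of the complement of `S`. -/
def IsComplComponent (S F : Set (ℝ × ℝ)) : Prop :=
  ∃ x ∉ S, F = connectedComponentIn Sᶜ x

namespace IsComplComponent

variable {S F F' : Set (ℝ × ℝ)}

theorem isPreconnected (h : IsComplComponent S F) : IsPreconnected F := by
  obtain ⟨x, -, rfl⟩ := h
  exact isPreconnected_connectedComponentIn

theorem subset_compl (h : IsComplComponent S F) : F ⊆ Sᶜ := by
  obtain ⟨x, -, rfl⟩ := h
  exact connectedComponentIn_subset _ _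

theorem nonempty (h : IsComplComponent S F) : F.Nonempty := by
  obtain ⟨x, hx, rfl⟩ := h
  exact ⟨x, mem_connectedComponentIn hx⟩

theorem eq_connectedComponentIn (h : IsComplComponent S F) {z : ℝ × ℝ} (hz : z ∈ F) :
    F = connectedComponentIn Sᶜ z := by
  obtain ⟨x, hx, rfl⟩ := h
  exact connectedComponentIn_eq hz

theorem of_notMem {z : ℝ × ℝ} (hz : z ∉ S) : IsComplComponent S (connectedComponentIn Sᶜ z) :=
  ⟨z, hz, rfl⟩

theorem eq_of_mem (h : IsComplComponent S F) (h' : IsComplComponent S F') {z : ℝ × ℝ}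
    (hz : z ∈ F) (hz' : z ∈ F') : F = F' :=
  (h.eq_connectedComponentIn hz).trans (h'.eq_connectedComponentIn hz').symm

theorem subset_of_isPreconnected (h : IsComplComponent S F) {T : Set (ℝ × ℝ)}
    (hT : IsPreconnected T) (hTS : T ⊆ Sᶜ) {z : ℝ × ℝ} (hz : z ∈ F) (hz' : z ∈ T) : T ⊆ F := by
  rw [h.eq_connectedComponentIn hz]
  exact hT.subset_connectedComponentIn hz' hTS

theorem isOpen (h : IsComplComponent S F) (hS : IsClosed S) : IsOpen F := by
  obtain ⟨x, -, rfl⟩ := h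
  exact hS.isOpen_compl.connectedComponentIn

theorem frontier_subset (h : IsComplComponent S F) (hS : IsClosed S) : frontier F ⊆ S := by
  intro z hz
  by_contra hzS
  have h' := of_notMem hzS
  obtain ⟨w, hw, hw'⟩ := mem_closure_iff.1 hz.1 _ (h'.isOpen hS) (mem_connectedComponentIn hzS)
  have : z ∈ F := (h.eq_of_mem h' hw' hw) ▸ mem_connectedComponentIn hzS
  exact hz.2 ((h.isOpen hS).interior_eq.symm ▸ this)

theorem joinedIn (h : IsComplComponent S F) (hS : IsClosed S) {z w : ℝ × ℝ} (hz : z ∈ F)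
    (hw : w ∈ F) : JoinedIn F z w :=
  ((h.isOpen hS).isConnected_iff_isPathConnected.1 ⟨h.nonempty, h.isPreconnected⟩).joinedIn
    z hz w hw

/-- A bounded set has only one unbounded complementary component. -/
theorem eq_of_not_isBounded (h : IsComplComponent S F) (h' : IsComplComponent S F')
    (hS : Bornology.IsBounded S) (hF : ¬ Bornology.IsBounded F)
    (hF' : ¬ Bornology.IsBounded F') : F = F' := by
  obtain ⟨R, hR0, hR⟩ := exists_forall_norm_disp_lt hS 0
  have hT : {z : ℝ × ℝ | R < ‖disp 0 z‖} ⊆ Sᶜ := fun z hz hzS => (hR z hzS).not_gt hz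
  have hfar : ∀ A : Set (ℝ × ℝ), ¬ Bornology.IsBounded A →
      ∃ z ∈ A, R < ‖disp 0 z‖ := by
    intro A hA
    by_contra! hcon
    refine hA (isBounded_iff_forall_norm_le.2 ⟨R, fun z hz => ?_⟩)
    simpa using (norm_sub_le_norm_disp 0 z).trans (hcon z hz)
  obtain ⟨z, hz, hzR⟩ := hfar F hF
  obtain ⟨w, hw, hwR⟩ := hfar F' hF'
  exact h.eq_of_mem h' (h.subset_of_isPreconnected (isPreconnected_setOf_lt_norm_disp hR0) hT hz
    hzR hwR) hw

end IsComplComponent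

/-- Two functions whose windings along a piece `K` are trivial have, after adding an arc-like
piece `A` attached at two points, linearly dependent windings on `K ∪ A`. -/
theorem exists_zpow_mul_zpow_hasContLog {X : Type*} [TopologicalSpace X] {K A : Set X}
    (hK : IsClosed K) (hA : IsClosed A) {x y : X} (hx : x ∈ K ∩ A) (hy : y ∈ K ∩ A)
    (hKA : K ∩ A ⊆ {x, y}) {f₁ f₂ : X → ℂ} (h₁ : HasContLog f₁ K) (h₂ : HasContLog f₂ K)
    (h₁' : HasContLog f₁ A) (h₂' : HasContLog f₂ A) :
    ∃ a b : ℤ, (a ≠ 0 ∨ b ≠ 0) ∧ HasContLog (fun z => f₁ z ^ a * f₂ z ^ b) (K ∪ A) := by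
  have main : ∀ f : X → ℂ, HasContLog f K → HasContLog f A → ∃ (g h : X → ℂ) (m : ℤ),
      ContinuousOn g K ∧ ContinuousOn h A ∧ (∀ z ∈ K, exp (g z) = f z) ∧
      (∀ z ∈ A, exp (h z) = f z) ∧ g x = h x ∧ g y = h y + m * (2 * Real.pi * I) := by
    rintro f ⟨g, hg, hge⟩ ⟨h, hh, hhe⟩
    have he : ∀ z ∈ A, exp (h z + (g x - h x)) = f z := by
      intro z hz
      rw [exp_add, exp_sub, hhe z hz, hhe x hx.2, hge x hx.1, div_self, mul_one]
      rw [← hge x hx.1]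
      exact exp_ne_zero _
    obtain ⟨m, hm⟩ := exp_eq_exp_iff_exists_int.1 ((hge y hy.1).trans (he y hy.2).symm)
    exact ⟨g, fun z => h z + (g x - h x), m, hg, hh.add continuousOn_const, hge, he, by simp, hm⟩
  obtain ⟨g₁, k₁, m₁, cg₁, ck₁, eg₁, ek₁, x₁, y₁⟩ := main f₁ h₁ h₁'
  obtain ⟨g₂, k₂, m₂, cg₂, ck₂, eg₂, ek₂, x₂, y₂⟩ := main f₂ h₂ h₂'
  have comb : ∀ a b : ℤ, a * m₁ + b * m₂ = 0 →
      HasContLog (fun z => f₁ z ^ a * f₂ z ^ b) (K ∪ A) := by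
    intro a b hab
    refine HasContLog.glue (g := fun z => a * g₁ z + b * g₂ z) (g' := fun z => a * k₁ z + b * k₂ z)
      hK hA (by fun_prop) (by fun_prop) ?_ ?_ ?_
    · intro z hz
      rw [exp_add, exp_int_mul, exp_int_mul, eg₁ z hz, eg₂ z hz]
    · intro z hz
      rw [exp_add, exp_int_mul, exp_int_mul, ek₁ z hz, ek₂ z hz]
    · intro z hz
      rcases hKA hz with rfl | rfl
      · rw [x₁, x₂]
      · have hab' : (a : ℂ) * m₁ + b * m₂ = 0 := by exact_mod_cast hab
        rw [y₁, y₂]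
        linear_combination hab' * (2 * Real.pi * I)
  by_cases hm : m₁ = 0 ∧ m₂ = 0
  · exact ⟨1, 0, by simp, comb 1 0 (by simp [hm])⟩
  · exact ⟨m₂, -m₁, by omega, comb _ _ (by ring)⟩

theorem IsComplComponent.notMem_closure {S F F' : Set (ℝ × ℝ)} (h : IsComplComponent S F)
    (h' : IsComplComponent S F') (hS : IsClosed S) (hne : F ≠ F') {z : ℝ × ℝ} (hz : z ∈ F') :
    z ∉ closure F := by
  intro hc
  obtain ⟨w, hw', hw⟩ := mem_closure_iff.1 hc F' (h'.isOpen hS) hz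
  exact hne (h.eq_of_mem h' hw hw')

/-- A plane arc, all of whose points are images of `[0, 1]`, attached to `K` only at its ends. -/
structure IsAttachedArc (K : Set (ℝ × ℝ)) (γ : ℝ → ℝ × ℝ) : Prop where
  continuousOn : ContinuousOn γ (Icc 0 1)
  injOn : InjOn γ (Icc 0 1)
  inter_subset : K ∩ γ '' Icc 0 1 ⊆ {γ 0, γ 1}
  zero_mem : γ 0 ∈ K
  one_mem : γ 1 ∈ K

namespace IsAttachedArc

variable {K : Set (ℝ × ℝ)} {γ : ℝ → ℝ × ℝ}

theorem isCompact (h : IsAttachedArc K γ) : IsCompact (γ '' Icc 0 1) :=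
  isCompact_Icc.image_of_continuousOn h.continuousOn

theorem notMem (h : IsAttachedArc K γ) {t : ℝ} (ht : t ∈ Ioo (0 : ℝ) 1) : γ t ∉ K := by
  intro hK
  have hti := Ioo_subset_Icc_self ht
  rcases h.inter_subset ⟨hK, mem_image_of_mem γ hti⟩ with h' | h'
  · exact ht.1.ne' (h.injOn hti (by simp) h')
  · exact ht.2.ne (h.injOn hti (by simp) h')

/-- Near an inner point of an attached arc whose ends are joined in `K`, the complement of
`K ∪ γ` is not connected. -/
theorem exists_connectedComponentIn_ne (h : IsAttachedArc K γ)
    (hj : JoinedIn K (γ 0) (γ 1)) {t : ℝ} (ht : t ∈ Ioo (0 : ℝ) 1) {W : Set (ℝ × ℝ)}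
    (hW : IsOpen W) (htW : γ t ∈ W) (hWK : Disjoint W K) :
    ∃ u ∈ W \ γ '' Icc 0 1, ∃ v ∈ W \ γ '' Icc 0 1,
      connectedComponentIn (K ∪ γ '' Icc 0 1)ᶜ u ≠ connectedComponentIn (K ∪ γ '' Icc 0 1)ᶜ v := by
  classical
  set A := γ '' Icc 0 1 with hA
  by_contra! hcon
  have hAc : IsClosed A := h.isCompact.isClosed
  have hjA : JoinedIn A (γ 1) (γ 0) :=
    (((convex_Icc (0 : ℝ) 1).isPathConnected ⟨0, by simp⟩).image' h.continuousOn).joinedIn _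
      (mem_image_of_mem _ (by simp)) _ (mem_image_of_mem _ (by simp))
  obtain ⟨gA, cgA, egA⟩ := hasContLog_disp_div_of_joinedIn hjA (disjoint_compl_left (a := A))
  obtain ⟨gK, cgK, egK⟩ := hasContLog_disp_div_of_joinedIn hj.symm (disjoint_compl_left (a := K))
  have hWK' : W ⊆ Kᶜ := hWK.subset_compl_right
  obtain ⟨c, hc1, hc⟩ : ∃ c : ℂ, exp c = 1 ∧ ∀ u ∈ W \ A, gA u = gK u + c := by
    have hs1 : ∀ u ∈ (K ∪ A)ᶜ, exp (gA u - gK u) = 1 := by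
      intro u hu
      rw [compl_union] at hu
      rw [exp_sub, egA u hu.2, egK u hu.1, div_self]
      rw [← egA u hu.2]
      exact exp_ne_zero _
    by_cases hemp : (W \ A).Nonempty
    · obtain ⟨u₀, hu₀⟩ := hemp
      have hmem : ∀ u ∈ W \ A, u ∈ (K ∪ A)ᶜ := fun u hu => by
        rw [compl_union]; exact ⟨hWK' hu.1, hu.2⟩
      refine ⟨gA u₀ - gK u₀, hs1 _ (hmem _ hu₀), fun u hu => ?_⟩
      have hsub := connectedComponentIn_subset (K ∪ A)ᶜ u₀
      have := (isPreconnected_connectedComponentIn (F := (K ∪ A)ᶜ) (x := u₀)).eq_of_exp_eq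
        (k := fun z => gA z - gK z)
        ((cgA.mono (hsub.trans (compl_subset_compl.2 subset_union_right))).sub
          (cgK.mono (hsub.trans (compl_subset_compl.2 subset_union_left))))
        (fun z hz => hs1 z (hsub hz))
        (hcon u₀ hu₀ u hu ▸ mem_connectedComponentIn (hmem u hu))
        (mem_connectedComponentIn (hmem _ hu₀))
      linear_combination this
    · exact ⟨0, exp_zero, fun u hu => absurd ⟨u, hu⟩ hemp⟩
  have hlog : HasContLog (fun z => disp (γ 0) z / disp (γ 1) z) (Aᶜ ∪ W) := by
    have e1 : EqOn (fun z => if z ∈ A then gK z + c else gA z) gA Aᶜ := fun z hz => if_neg hz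
    have e2 : EqOn (fun z => if z ∈ A then gK z + c else gA z) (fun z => gK z + c) W := by
      intro z hz
      by_cases hzA : z ∈ A
      · simp [hzA]
      · simp [hzA, hc z ⟨hz, hzA⟩]
    refine ⟨fun z => if z ∈ A then gK z + c else gA z, ?_, ?_⟩
    · exact ContinuousOn.union_of_isOpen (cgA.congr e1)
        (((cgK.mono hWK').add continuousOn_const).congr e2) hAc.isOpen_compl hW
    · rintro z (hz | hz)
      · rw [e1 hz, egA z hz]
      · rw [e2 hz]
        simp only
        rw [exp_add, hc1, mul_one, egK z (hWK' hz)]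
  obtain ⟨t₁, t₂, ht₁, ht₂, h12, hmid⟩ : ∃ t₁ t₂ : ℝ, 0 ≤ t₁ ∧ t₂ ≤ 1 ∧ t₁ < t₂ ∧
      ∀ s ∈ Ioo t₁ t₂, γ s ∈ W := by
    have hca : ContinuousAt γ t := h.continuousOn.continuousAt (Icc_mem_nhds ht.1 ht.2)
    obtain ⟨δ, hδ, hball⟩ := Metric.mem_nhds_iff.1 (hca.preimage_mem_nhds (hW.mem_nhds htW))
    refine ⟨max 0 (t - δ), min 1 (t + δ), le_max_left _ _, min_le_left _ _, ?_, fun s hs => ?_⟩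
    · exact (max_lt ht.1 (by linarith)).trans (lt_min ht.2 (by linarith))
    · refine hball ?_
      have h1 := (le_max_right 0 (t - δ)).trans_lt hs.1
      have h2 := hs.2.trans_le (min_le_right 1 (t + δ))
      rw [Metric.mem_ball, Real.dist_eq, abs_lt]
      constructor <;> linarith
  have hs₁ : Icc 0 t₁ ⊆ Icc (0 : ℝ) 1 := Icc_subset_Icc_right (h12.le.trans ht₂)
  have hs₂ : Icc t₂ 1 ⊆ Icc (0 : ℝ) 1 := Icc_subset_Icc_left (ht₁.trans h12.le)
  have hc₁ : IsCompact (γ '' Icc 0 t₁) :=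
    isCompact_Icc.image_of_continuousOn (h.continuousOn.mono hs₁)
  have hc₂ : IsCompact (γ '' Icc t₂ 1) :=
    isCompact_Icc.image_of_continuousOn (h.continuousOn.mono hs₂)
  have hdisj : γ '' Icc 0 t₁ ⊆ (γ '' Icc t₂ 1)ᶜ := by
    rintro _ ⟨a, ha, rfl⟩ ⟨b, hb, hab⟩
    have := h.injOn (hs₂ hb) (hs₁ ha) hab
    have := ha.2
    have := hb.1
    linarith
  obtain ⟨U, hU, h1U, hUc, hUcpt⟩ :=
    exists_open_between_and_isCompact_closure hc₁ hc₂.isClosed.isOpen_compl hdisj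
  have h1 : γ 1 ∉ closure U := fun hmem => hUc hmem (mem_image_of_mem _ ⟨ht₂, le_rfl⟩)
  have hne : ∀ z ∈ closure U, disp (γ 1) z ≠ 0 := fun z hz =>
    disp_ne_zero fun e => h1 (e ▸ hz)
  have hfr : frontier U ⊆ Aᶜ ∪ W := by
    intro z hz
    by_contra hz'
    simp only [mem_union, mem_compl_iff, not_or, not_not] at hz'
    obtain ⟨⟨s, hs, rfl⟩, hzW⟩ := hz'
    rcases le_or_gt s t₁ with h' | h'
    · exact hz.2 (hU.interior_eq.symm ▸ h1U (mem_image_of_mem _ ⟨hs.1, h'⟩))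
    · rcases le_or_gt t₂ s with h'' | h''
      · exact hUc hz.1 (mem_image_of_mem _ ⟨h'', hs.2⟩)
      · exact hzW (hmid s ⟨h', h''⟩)
  have := eq_zero_of_hasContLog_frontier hU (hUcpt.isBounded.subset subset_closure)
    (p := γ 0) (h1U (mem_image_of_mem _ ⟨le_rfl, ht₁⟩)) (Φ := fun z => (disp (γ 1) z)⁻¹)
    (ContinuousOn.inv₀ (by fun_prop) hne) (fun z hz => inv_ne_zero (hne z hz)) (n := 1)
    ((hlog.mono hfr).congr fun z _ => by rw [zpow_one, div_eq_mul_inv])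
  exact one_ne_zero this

theorem false_of_isBounded (h : IsAttachedArc K γ) (hK : IsCompact K) {V : Set (ℝ × ℝ)}
    (hV : IsComplComponent K V) {U₁ U₂ U₃ : Set (ℝ × ℝ)}
    (h₁ : IsComplComponent (K ∪ γ '' Icc 0 1) U₁) (h₂ : IsComplComponent (K ∪ γ '' Icc 0 1) U₂)
    (h₃ : IsComplComponent (K ∪ γ '' Icc 0 1) U₃) (h12 : U₁ ≠ U₂) (h13 : U₁ ≠ U₃) (h23 : U₂ ≠ U₃)
    (hV₁ : (U₁ ∩ V).Nonempty) (hV₂ : (U₂ ∩ V).Nonempty) (hV₃ : (U₃ ∩ V).Nonempty)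
    (hb₁ : Bornology.IsBounded U₁) (hb₂ : Bornology.IsBounded U₂) : False := by
  have hKA : IsClosed (K ∪ γ '' Icc 0 1) := hK.isClosed.union h.isCompact.isClosed
  obtain ⟨p₁, hp₁, hv₁⟩ := hV₁
  obtain ⟨p₂, hp₂, hv₂⟩ := hV₂
  obtain ⟨p₃, hp₃, hv₃⟩ := hV₃
  have hd : ∀ {p z : ℝ × ℝ} {U : Set (ℝ × ℝ)}, IsComplComponent (K ∪ γ '' Icc 0 1) U → p ∈ U →
      z ∈ K ∪ γ '' Icc 0 1 → disp p z ≠ 0 := fun hU hp hz =>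
    disp_ne_zero fun e => hU.subset_compl hp (e ▸ hz)
  have hKV : Disjoint K V := disjoint_left.2 fun z hz hz' => hV.subset_compl hz' hz
  have hl : ∀ {p q : ℝ × ℝ}, p ∈ V → q ∈ V → HasContLog (fun z => disp q z / disp p z) K :=
    fun hp hq => hasContLog_disp_div_of_joinedIn (hV.joinedIn hK.isClosed hp hq) hKV
  have hlA : ∀ {p q : ℝ × ℝ} {U U' : Set (ℝ × ℝ)}, IsComplComponent (K ∪ γ '' Icc 0 1) U → p ∈ U →
      IsComplComponent (K ∪ γ '' Icc 0 1) U' → q ∈ U' →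
      HasContLog (fun z => disp q z / disp p z) (γ '' Icc 0 1) := fun hU hp hU' hq =>
    HasContLog.of_arc h.continuousOn h.injOn
      (ContinuousOn.div (by fun_prop) (by fun_prop) fun z hz => hd hU hp (Or.inr hz))
      (fun z hz => div_ne_zero (hd hU' hq (Or.inr hz)) (hd hU hp (Or.inr hz)))
  obtain ⟨a, b, hab, hlog⟩ := exists_zpow_mul_zpow_hasContLog hK.isClosed h.isCompact.isClosed
    ⟨h.zero_mem, mem_image_of_mem _ (by simp)⟩ ⟨h.one_mem, mem_image_of_mem _ (by simp)⟩
    h.inter_subset (hl hv₂ hv₁) (hl hv₃ hv₂) (hlA h₂ hp₂ h₁ hp₁) (hlA h₃ hp₃ h₂ hp₂)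
  have hcl : ∀ {p z : ℝ × ℝ} {U U' : Set (ℝ × ℝ)}, IsComplComponent (K ∪ γ '' Icc 0 1) U →
      IsComplComponent (K ∪ γ '' Icc 0 1) U' → U ≠ U' → p ∈ U' → z ∈ closure U → disp p z ≠ 0 :=
    fun hU hU' hne hp hz => disp_ne_zero fun e => hU.notMem_closure hU' hKA hne hp (e ▸ hz)
  have hcont : ∀ {p q : ℝ × ℝ} {m n : ℤ} {S : Set (ℝ × ℝ)}, (∀ z ∈ S, disp p z ≠ 0) →
      (∀ z ∈ S, disp q z ≠ 0) → ContinuousOn (fun z => disp p z ^ m * disp q z ^ n) S :=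
    fun hp hq => ContinuousOn.mul (ContinuousOn.zpow₀ (by fun_prop) _ fun z hz => Or.inl (hp z hz))
      (ContinuousOn.zpow₀ (by fun_prop) _ fun z hz => Or.inl (hq z hz))
  have ha : a = 0 := by
    refine eq_zero_of_hasContLog_frontier (h₁.isOpen hKA) hb₁ hp₁
      (Φ := fun z => disp p₂ z ^ (b - a) * disp p₃ z ^ (-b))
      (hcont (fun z => hcl h₁ h₂ h12 hp₂) (fun z => hcl h₁ h₃ h13 hp₃))
      (fun z hz => mul_ne_zero (zpow_ne_zero _ (hcl h₁ h₂ h12 hp₂ hz))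
        (zpow_ne_zero _ (hcl h₁ h₃ h13 hp₃ hz)))
      ((hlog.mono (h₁.frontier_subset hKA)).congr fun z hz => ?_)
    have hz' := h₁.frontier_subset hKA hz
    have n2 := hd h₂ hp₂ hz'
    have n3 := hd h₃ hp₃ hz'
    rw [div_zpow, div_zpow, zpow_sub₀ n2, zpow_neg]
    field_simp
  have hb : b - a = 0 := by
    refine eq_zero_of_hasContLog_frontier (h₂.isOpen hKA) hb₂ hp₂
      (Φ := fun z => disp p₁ z ^ a * disp p₃ z ^ (-b))
      (hcont (fun z => hcl h₂ h₁ h12.symm hp₁) (fun z => hcl h₂ h₃ h23 hp₃))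
      (fun z hz => mul_ne_zero (zpow_ne_zero _ (hcl h₂ h₁ h12.symm hp₁ hz))
        (zpow_ne_zero _ (hcl h₂ h₃ h23 hp₃ hz)))
      ((hlog.mono (h₂.frontier_subset hKA)).congr fun z hz => ?_)
    have hz' := h₂.frontier_subset hKA hz
    have n2 := hd h₂ hp₂ hz'
    have n3 := hd h₃ hp₃ hz'
    rw [div_zpow, div_zpow, zpow_sub₀ n2, zpow_neg]
    field_simp
  omega

/-- Attaching an arc splits a complementary component into at most two pieces. -/
theorem eq_or_eq_or_eq (h : IsAttachedArc K γ) (hK : IsCompact K) {V : Set (ℝ × ℝ)}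
    (hV : IsComplComponent K V) {U₁ U₂ U₃ : Set (ℝ × ℝ)}
    (h₁ : IsComplComponent (K ∪ γ '' Icc 0 1) U₁) (h₂ : IsComplComponent (K ∪ γ '' Icc 0 1) U₂)
    (h₃ : IsComplComponent (K ∪ γ '' Icc 0 1) U₃)
    (hV₁ : (U₁ ∩ V).Nonempty) (hV₂ : (U₂ ∩ V).Nonempty) (hV₃ : (U₃ ∩ V).Nonempty) :
    U₁ = U₂ ∨ U₁ = U₃ ∨ U₂ = U₃ := by
  by_contra! hne
  obtain ⟨h12, h13, h23⟩ := hne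
  have hKA := (hK.union h.isCompact).isBounded
  by_cases hb₁ : Bornology.IsBounded U₁
  · by_cases hb₂ : Bornology.IsBounded U₂
    · exact h.false_of_isBounded hK hV h₁ h₂ h₃ h12 h13 h23 hV₁ hV₂ hV₃ hb₁ hb₂
    · have hb₃ : Bornology.IsBounded U₃ := by
        by_contra hb₃
        exact h23 (h₂.eq_of_not_isBounded h₃ hKA hb₂ hb₃)
      exact h.false_of_isBounded hK hV h₁ h₃ h₂ h13 h12 h23.symm hV₁ hV₃ hV₂ hb₁ hb₃
  · have hb₂ : Bornology.IsBounded U₂ := by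
      by_contra hb₂
      exact h12 (h₁.eq_of_not_isBounded h₂ hKA hb₁ hb₂)
    have hb₃ : Bornology.IsBounded U₃ := by
      by_contra hb₃
      exact h13 (h₁.eq_of_not_isBounded h₃ hKA hb₁ hb₃)
    exact h.false_of_isBounded hK hV h₂ h₃ h₁ h23 h12.symm h13.symm hV₂ hV₃ hV₁ hb₂ hb₃

/-- Attaching an arc whose ends are joined in `K` splits exactly one complementary component
of `K` into exactly two, and the arc lies on the frontier of both. -/
theorem exists_split (h : IsAttachedArc K γ) (hK : IsCompact K)
    (hj : JoinedIn K (γ 0) (γ 1)) :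
    ∃ V U₁ U₂ : Set (ℝ × ℝ), IsComplComponent K V ∧ γ '' Ioo 0 1 ⊆ V ∧
      IsComplComponent (K ∪ γ '' Icc 0 1) U₁ ∧ IsComplComponent (K ∪ γ '' Icc 0 1) U₂ ∧
      U₁ ≠ U₂ ∧ U₁ ⊆ V ∧ U₂ ⊆ V ∧
      γ '' Icc 0 1 ⊆ frontier U₁ ∧ γ '' Icc 0 1 ⊆ frontier U₂ ∧
      ∀ F, IsComplComponent (K ∪ γ '' Icc 0 1) F → (F ∩ V).Nonempty → F = U₁ ∨ F = U₂ := by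
  have hhalf : (1 / 2 : ℝ) ∈ Ioo (0 : ℝ) 1 := by norm_num
  have hKA : IsClosed (K ∪ γ '' Icc 0 1) := (hK.union h.isCompact).isClosed
  have hV := IsComplComponent.of_notMem (h.notMem hhalf)
  set V := connectedComponentIn Kᶜ (γ (1 / 2)) with hVdef
  have hIV : γ '' Ioo 0 1 ⊆ V := by
    refine hV.subset_of_isPreconnected
      (isPreconnected_Ioo.image _ (h.continuousOn.mono Ioo_subset_Icc_self)) ?_
      (mem_connectedComponentIn (h.notMem hhalf)) (mem_image_of_mem _ hhalf)
    rintro _ ⟨t, ht, rfl⟩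
    exact h.notMem ht
  have hVo := hV.isOpen hK.isClosed
  have hnot : ∀ {u W}, W ⊆ V → u ∈ W \ γ '' Icc 0 1 → u ∉ K ∪ γ '' Icc 0 1 :=
    fun hWV hu hu' => hu'.elim (hV.subset_compl (hWV hu.1)) hu.2
  have hVK : Disjoint V K := disjoint_left.2 hV.subset_compl
  obtain ⟨u, hu, v, hv, huv⟩ := h.exists_connectedComponentIn_ne hj hhalf hVo
    (hIV (mem_image_of_mem _ hhalf)) hVK
  have hu' := hnot Subset.rfl hu
  have hv' := hnot Subset.rfl hv
  have hU₁ := IsComplComponent.of_notMem hu'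
  have hU₂ := IsComplComponent.of_notMem hv'
  have mU₁ := mem_connectedComponentIn (mem_compl hu')
  have mU₂ := mem_connectedComponentIn (mem_compl hv')
  have htwo : ∀ F, IsComplComponent (K ∪ γ '' Icc 0 1) F → (F ∩ V).Nonempty →
      F = connectedComponentIn (K ∪ γ '' Icc 0 1)ᶜ u ∨
      F = connectedComponentIn (K ∪ γ '' Icc 0 1)ᶜ v := by
    intro F hF hFV
    rcases h.eq_or_eq_or_eq hK hV hF hU₁ hU₂ hFV ⟨u, mU₁, hu.1⟩ ⟨v, mU₂, hv.1⟩ with h' | h' | h'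
    · exact Or.inl h'
    · exact Or.inr h'
    · exact absurd h' huv
  have hsub : ∀ {w}, w ∈ V → w ∉ K ∪ γ '' Icc 0 1 →
      connectedComponentIn (K ∪ γ '' Icc 0 1)ᶜ w ⊆ V := fun hw hw' =>
    hV.subset_of_isPreconnected isPreconnected_connectedComponentIn
      ((connectedComponentIn_subset _ _).trans (compl_subset_compl.2 subset_union_left)) hw
      (mem_connectedComponentIn hw')
  have hcl : ∀ t ∈ Ioo (0 : ℝ) 1,
      γ t ∈ closure (connectedComponentIn (K ∪ γ '' Icc 0 1)ᶜ u) ∧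
      γ t ∈ closure (connectedComponentIn (K ∪ γ '' Icc 0 1)ᶜ v) := by
    intro t ht
    rw [mem_closure_iff, mem_closure_iff, ← forall_and]
    intro W
    rw [← forall_and]
    intro hW
    rw [← forall_and]
    intro htW
    obtain ⟨u', hu', v', hv', huv'⟩ := h.exists_connectedComponentIn_ne hj ht
      (hW.inter hVo) ⟨htW, hIV (mem_image_of_mem _ ht)⟩ (hVK.mono_left inter_subset_right)
    have nu := hnot inter_subset_right hu'
    have nv := hnot inter_subset_right hv'
    have mu := mem_connectedComponentIn (mem_compl nu)
    have mv := mem_connectedComponentIn (mem_compl nv)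
    rcases htwo _ (.of_notMem nu) ⟨u', mu, hu'.1.2⟩ with e | e <;>
    rcases htwo _ (.of_notMem nv) ⟨v', mv, hv'.1.2⟩ with e' | e'
    · exact absurd (e.trans e'.symm) huv'
    · exact ⟨⟨u', hu'.1.1, e ▸ mu⟩, ⟨v', hv'.1.1, e' ▸ mv⟩⟩
    · exact ⟨⟨v', hv'.1.1, e' ▸ mv⟩, ⟨u', hu'.1.1, e ▸ mu⟩⟩
    · exact absurd (e.trans e'.symm) huv'
  have hfr : ∀ U, IsComplComponent (K ∪ γ '' Icc 0 1) U → (∀ t ∈ Ioo (0 : ℝ) 1, γ t ∈ closure U) →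
      γ '' Icc 0 1 ⊆ frontier U := by
    intro U hU hc z hz
    refine ⟨?_, fun hz' => hU.subset_compl (interior_subset hz') (Or.inr hz)⟩
    have hIcc : closure (Ioo (0 : ℝ) 1) = Icc 0 1 := closure_Ioo zero_ne_one
    have h1 : γ '' closure (Ioo 0 1) ⊆ closure (γ '' Ioo 0 1) :=
      (hIcc ▸ h.continuousOn).image_closure
    rw [hIcc] at h1
    refine closure_minimal ?_ isClosed_closure (h1 hz)
    rintro _ ⟨t, ht, rfl⟩
    exact hc t ht
  exact ⟨V, _, _, hV, hIV, hU₁, hU₂, huv, hsub hu.1 hu', hsub hv.1 hv',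
    hfr _ hU₁ fun t ht => (hcl t ht).1, hfr _ hU₂ fun t ht => (hcl t ht).2, htwo⟩

end IsAttachedArc

/-- A compact set without winding does not separate the plane. -/
theorem IsComplComponent.eq_of_hasContLog {S F F' : Set (ℝ × ℝ)} (hS : IsCompact S)
    (hlog : ∀ f : ℝ × ℝ → ℂ, ContinuousOn f S → (∀ z ∈ S, f z ≠ 0) → HasContLog f S)
    (h : IsComplComponent S F) (h' : IsComplComponent S F') : F = F' := by
  have key : ∀ U, IsComplComponent S U → ¬ Bornology.IsBounded U := by
    intro U hU hb
    obtain ⟨p, hp⟩ := hU.nonempty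
    refine one_ne_zero (eq_zero_of_hasContLog_frontier (hU.isOpen hS.isClosed) hb hp
      (Φ := fun _ => 1) continuousOn_const (fun _ _ => one_ne_zero) (n := 1)
      (((hlog (disp p) (by fun_prop) fun z hz => disp_ne_zero fun e =>
        hU.subset_compl hp (e ▸ hz)).mono (hU.frontier_subset hS.isClosed)).congr fun z _ => ?_))
    simp
  exact h.eq_of_not_isBounded h' hS.isBounded (key _ h) (key _ h')

end PlaneTopology

namespace SimpleGraph.PlaneEmbedding

open Topology

variable {V : Type*} {G : SimpleGraph V} (E : G.PlaneEmbedding)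

theorem exists_param {u v : V} (h : s(u, v) ∈ G.edgeSet) :
    ∃ γ : ℝ → ℝ × ℝ, ContinuousOn γ (Icc 0 1) ∧ InjOn γ (Icc 0 1) ∧
      γ '' Icc 0 1 = E.arc s(u, v) ∧ γ 0 = E.vpos u ∧ γ 1 = E.vpos v :=
  E.arc_spec _ h u v rfl

theorem isCompact_arc {e : Sym2 V} (he : e ∈ G.edgeSet) : IsCompact (E.arc e) := by
  induction e with
  | h u v =>
    obtain ⟨γ, hγ, -, him, -⟩ := E.exists_param he
    exact him ▸ isCompact_Icc.image_of_continuousOn hγ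

theorem vpos_mem_arc_of_mem {e : Sym2 V} (he : e ∈ G.edgeSet) {v : V} (hv : v ∈ e) :
    E.vpos v ∈ E.arc e := by
  obtain ⟨u, rfl⟩ := Sym2.mem_iff_exists.1 hv
  obtain ⟨γ, -, -, him, h0, -⟩ := E.exists_param he
  rw [← him, ← h0]
  exact mem_image_of_mem _ (by simp)

/-- The points used by the vertices and the edges in `S`. -/
def partialDrawing (S : Set (Sym2 V)) : Set (ℝ × ℝ) :=
  range E.vpos ∪ ⋃ e ∈ S, E.arc e

theorem vpos_mem_partialDrawing (S : Set (Sym2 V)) (v : V) : E.vpos v ∈ E.partialDrawing S :=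
  Or.inl (mem_range_self v)

theorem arc_subset_partialDrawing {S : Set (Sym2 V)} {e : Sym2 V} (he : e ∈ S) :
    E.arc e ⊆ E.partialDrawing S :=
  (subset_biUnion_of_mem (u := E.arc) he).trans subset_union_right

theorem partialDrawing_mono {S T : Set (Sym2 V)} (h : S ⊆ T) :
    E.partialDrawing S ⊆ E.partialDrawing T :=
  union_subset_union_right _ (biUnion_subset_biUnion_left h)

theorem partialDrawing_insert (S : Set (Sym2 V)) (e : Sym2 V) :
    E.partialDrawing (insert e S) = E.partialDrawing S ∪ E.arc e := by
  simp only [partialDrawing, biUnion_insert]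
  rw [union_comm (E.arc e), union_assoc]

theorem isCompact_partialDrawing [Finite V] {S : Set (Sym2 V)} (hS : S ⊆ G.edgeSet) :
    IsCompact (E.partialDrawing S) :=
  (finite_range _).isCompact.union
    (S.toFinite.isCompact_biUnion fun _ he => E.isCompact_arc (hS he))

theorem joinedIn_partialDrawing {S : Set (Sym2 V)} (hS : S ⊆ G.edgeSet) {u v : V}
    (h : (fromEdgeSet S).Reachable u v) :
    JoinedIn (E.partialDrawing S) (E.vpos u) (E.vpos v) := by
  obtain ⟨w⟩ := h
  induction w with
  | nil => exact JoinedIn.refl (E.vpos_mem_partialDrawing S _)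
  | @cons u v _ h _ ih =>
    have he : s(u, v) ∈ S := ((fromEdgeSet_adj _).1 h).1
    obtain ⟨γ, hγ, -, him, h0, h1⟩ := E.exists_param (hS he)
    have hj : JoinedIn (E.arc s(u, v)) (E.vpos u) (E.vpos v) := by
      rw [← him, ← h0, ← h1]
      exact (((convex_Icc (0 : ℝ) 1).isPathConnected ⟨0, by simp⟩).image' hγ).joinedIn _
        (mem_image_of_mem _ (by simp)) _ (mem_image_of_mem _ (by simp))
    exact (hj.mono (E.arc_subset_partialDrawing he)).trans ih

theorem partialDrawing_inter_arc {S : Set (Sym2 V)} (hS : S ⊆ G.edgeSet) {e : Sym2 V}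
    (he : e ∈ G.edgeSet) (heS : e ∉ S) {z : ℝ × ℝ} (hz : z ∈ E.partialDrawing S)
    (hz' : z ∈ E.arc e) : ∃ v ∈ e, z = E.vpos v := by
  rcases hz with ⟨v, rfl⟩ | hz
  · exact ⟨v, E.vpos_mem_arc e he v hz', rfl⟩
  · obtain ⟨f, hf, hzf⟩ := mem_iUnion₂.1 hz
    obtain ⟨v, -, hv, rfl⟩ := E.arc_inter f (hS hf) e he (fun h => heS (h ▸ hf)) ⟨hzf, hz'⟩
    exact ⟨v, hv, rfl⟩

/-- Adding the edge `e` to the edges in `S` splits the component `W` into `U₁` and `U₂`. -/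
structure IsSplit (S : Set (Sym2 V)) (e : Sym2 V) (W U₁ U₂ : Set (ℝ × ℝ)) : Prop where
  comp : IsComplComponent (E.partialDrawing S) W
  comp₁ : IsComplComponent (E.partialDrawing (insert e S)) U₁
  comp₂ : IsComplComponent (E.partialDrawing (insert e S)) U₂
  ne : U₁ ≠ U₂
  subset₁ : U₁ ⊆ W
  subset₂ : U₂ ⊆ W
  arc_subset : E.arc e ⊆ W ∪ range E.vpos
  inter_nonempty : (E.arc e ∩ W).Nonempty
  frontier₁ : E.arc e ⊆ frontier U₁
  frontier₂ : E.arc e ⊆ frontier U₂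
  eq_or_eq : ∀ F, IsComplComponent (E.partialDrawing (insert e S)) F → (F ∩ W).Nonempty →
    F = U₁ ∨ F = U₂

theorem exists_isSplit [Finite V] {S : Set (Sym2 V)} (hS : S ⊆ G.edgeSet) {u v : V}
    (he : s(u, v) ∈ G.edgeSet) (heS : s(u, v) ∉ S) (h : (fromEdgeSet S).Reachable u v) :
    ∃ W U₁ U₂, E.IsSplit S s(u, v) W U₁ U₂ := by
  obtain ⟨γ, hγ, hi, him, h0, h1⟩ := E.exists_param he
  have harc : IsAttachedArc (E.partialDrawing S) γ := by
    refine ⟨hγ, hi, ?_, h0 ▸ E.vpos_mem_partialDrawing S u, h1 ▸ E.vpos_mem_partialDrawing S v⟩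
    rintro z ⟨hz, hz'⟩
    obtain ⟨w, hw, rfl⟩ := E.partialDrawing_inter_arc hS he heS hz (him ▸ hz')
    rcases Sym2.mem_iff.1 hw with rfl | rfl
    · exact Or.inl h0.symm
    · exact Or.inr h1.symm
  obtain ⟨W, U₁, U₂, hW, hIW, hU₁, hU₂, hne, hs₁, hs₂, hf₁, hf₂, htwo⟩ := harc.exists_split
    (E.isCompact_partialDrawing hS) (h0.symm ▸ h1.symm ▸ E.joinedIn_partialDrawing hS h)
  rw [him, ← partialDrawing_insert] at hU₁ hU₂ htwo
  rw [him] at hf₁ hf₂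
  refine ⟨W, U₁, U₂, hW, hU₁, hU₂, hne, hs₁, hs₂, ?_, ?_, hf₁, hf₂, htwo⟩
  · rw [← him]
    rintro _ ⟨t, ht, rfl⟩
    rcases eq_or_ne t 0 with rfl | ht0
    · exact Or.inr ⟨u, h0.symm⟩
    rcases eq_or_ne t 1 with rfl | ht1
    · exact Or.inr ⟨v, h1.symm⟩
    exact Or.inl (hIW (mem_image_of_mem _
      ⟨lt_of_le_of_ne ht.1 ht0.symm, lt_of_le_of_ne ht.2 ht1⟩))
  · have hhalf : (1 / 2 : ℝ) ∈ Ioo (0 : ℝ) 1 := by norm_num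
    exact ⟨γ (1 / 2), him ▸ mem_image_of_mem _ (Ioo_subset_Icc_self hhalf),
      hIW (mem_image_of_mem _ hhalf)⟩

namespace IsSplit

variable {E} {S : Set (Sym2 V)} {e : Sym2 V} {W U₁ U₂ : Set (ℝ × ℝ)}

theorem subset_compl_insert (h : E.IsSplit S e W U₁ U₂) {F : Set (ℝ × ℝ)}
    (hF : IsComplComponent (E.partialDrawing S) F) (hne : F ≠ W) :
    F ⊆ (E.partialDrawing (insert e S))ᶜ := by
  intro z hz hz'
  rw [partialDrawing_insert] at hz'
  rcases hz' with hz' | hz'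
  · exact hF.subset_compl hz hz'
  · rcases h.arc_subset hz' with hz' | ⟨v, rfl⟩
    · exact hne (hF.eq_of_mem h.comp hz hz')
    · exact hF.subset_compl hz (E.vpos_mem_partialDrawing S v)

theorem isComplComponent_insert_iff (h : E.IsSplit S e W U₁ U₂) {F : Set (ℝ × ℝ)} :
    IsComplComponent (E.partialDrawing (insert e S)) F ↔
      (IsComplComponent (E.partialDrawing S) F ∧ F ≠ W) ∨ F = U₁ ∨ F = U₂ := by
  have hmono : (E.partialDrawing (insert e S))ᶜ ⊆ (E.partialDrawing S)ᶜ :=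
    compl_subset_compl.2 (E.partialDrawing_mono (subset_insert e S))
  constructor
  · intro hF
    by_cases hFW : (F ∩ W).Nonempty
    · exact Or.inr (h.eq_or_eq F hF hFW)
    · left
      obtain ⟨z, hz⟩ := hF.nonempty
      have hzS := hmono (hF.subset_compl hz)
      have hC := IsComplComponent.of_notMem hzS
      have hzC := mem_connectedComponentIn hzS
      have hne : connectedComponentIn (E.partialDrawing S)ᶜ z ≠ W := by
        rintro e
        exact hFW ⟨z, hz, e ▸ hzC⟩
      have heq : F = connectedComponentIn (E.partialDrawing S)ᶜ z :=
        (hC.subset_of_isPreconnected hF.isPreconnected (hF.subset_compl.trans hmono) hzC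
          hz).antisymm
        (hF.subset_of_isPreconnected hC.isPreconnected (h.subset_compl_insert hC hne) hz hzC)
      rw [heq]
      exact ⟨hC, hne⟩
  · rintro (⟨hF, hne⟩ | rfl | rfl)
    · obtain ⟨z, hz⟩ := hF.nonempty
      have hsub := h.subset_compl_insert hF hne
      have hC := IsComplComponent.of_notMem (hsub hz)
      have hzC := mem_connectedComponentIn (hsub hz)
      have heq : F = connectedComponentIn (E.partialDrawing (insert e S))ᶜ z :=
        (hC.subset_of_isPreconnected hF.isPreconnected hsub hzC hz).antisymm
        (hF.subset_of_isPreconnected hC.isPreconnected (hC.subset_compl.trans hmono) hz hzC)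
      exact heq ▸ hC
    · exact h.comp₁
    · exact h.comp₂

/-- The two new components are the only ones with the arc on their frontier. -/
theorem arc_subset_frontier_iff [Finite V] (h : E.IsSplit S e W U₁ U₂) (hS : S ⊆ G.edgeSet)
    {F : Set (ℝ × ℝ)} (hF : IsComplComponent (E.partialDrawing (insert e S)) F) :
    E.arc e ⊆ frontier F ↔ F = U₁ ∨ F = U₂ := by
  constructor
  · intro hfr
    obtain ⟨z, hz, hzW⟩ := h.inter_nonempty
    obtain ⟨w, hw, hwF⟩ := mem_closure_iff.1 (hfr hz).1 W
      (h.comp.isOpen (E.isCompact_partialDrawing hS).isClosed) hzW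
    exact h.eq_or_eq F hF ⟨w, hwF, hw⟩
  · rintro (rfl | rfl)
    · exact h.frontier₁
    · exact h.frontier₂

variable {P : Set (Sym2 V)} {J : Set (ℝ × ℝ)}

/-- The component containing an added edge lies in `J` iff the edge meets `J`. -/
theorem subset_iff (h : E.IsSplit S e W U₁ U₂) (hPS : P ⊆ S)
    (hJ : IsComplComponent (E.partialDrawing P) J) :
    W ⊆ J ↔ (E.arc e ∩ J).Nonempty := by
  constructor
  · intro hWJ
    exact h.inter_nonempty.mono (inter_subset_inter_right _ hWJ)
  · rintro ⟨z, hz, hzJ⟩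
    rcases h.arc_subset hz with hzW | ⟨v, rfl⟩
    · exact hJ.subset_of_isPreconnected h.comp.isPreconnected
        (h.comp.subset_compl.trans (compl_subset_compl.2 (E.partialDrawing_mono hPS))) hzJ hzW
    · exact absurd (E.vpos_mem_partialDrawing P v) (hJ.subset_compl hzJ)

theorem subset_of_subset (h : E.IsSplit S e W U₁ U₂) (hPS : P ⊆ S)
    (hJ : IsComplComponent (E.partialDrawing P) J) {U : Set (ℝ × ℝ)} (hU : U.Nonempty)
    (hUW : U ⊆ W) (hUJ : U ⊆ J) : W ⊆ J := by
  obtain ⟨z, hz⟩ := hU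
  exact hJ.subset_of_isPreconnected h.comp.isPreconnected
    (h.comp.subset_compl.trans (compl_subset_compl.2 (E.partialDrawing_mono hPS))) (hUJ hz)
    (hUW hz)

end IsSplit

/-- The components of the complement of the edges in `S` that lie in `J`. -/
def componentsIn (S : Set (Sym2 V)) (J : Set (ℝ × ℝ)) : Set (Set (ℝ × ℝ)) :=
  {F | IsComplComponent (E.partialDrawing S) F ∧ F ⊆ J}

theorem IsSplit.componentsIn_insert_of_subset {E : G.PlaneEmbedding} {S : Set (Sym2 V)}
    {e : Sym2 V} {W U₁ U₂ J : Set (ℝ × ℝ)} (h : E.IsSplit S e W U₁ U₂) (hJ : W ⊆ J) :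
    E.componentsIn (insert e S) J = insert U₁ (insert U₂ (E.componentsIn S J \ {W})) := by
  ext F
  simp only [componentsIn, mem_ofPred_eq, h.isComplComponent_insert_iff, mem_insert_iff, mem_sdiff,
    mem_singleton_iff]
  constructor
  · tauto
  · rintro (rfl | rfl | hF)
    · exact ⟨by simp, h.subset₁.trans hJ⟩
    · exact ⟨by simp, h.subset₂.trans hJ⟩
    · tauto

theorem ncard_componentsIn [Finite V] {P : Set (Sym2 V)} {J : Set (ℝ × ℝ)}
    (hP : P ⊆ G.edgeSet) (hconn : ∀ u v, (fromEdgeSet P).Reachable u v)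
    (hJ : IsComplComponent (E.partialDrawing P) J) (T : Finset (Sym2 V))
    (hT : (T : Set (Sym2 V)) ⊆ G.edgeSet \ P) :
    (E.componentsIn (T ∪ P) J).Finite ∧
      (E.componentsIn (T ∪ P) J).ncard =
        1 + {e ∈ (T : Set (Sym2 V)) | (E.arc e ∩ J).Nonempty}.ncard := by
  classical
  induction T using Finset.induction_on with
  | empty =>
    have : E.componentsIn P J = {J} := by
      ext F
      simp only [componentsIn, mem_ofPred_eq, mem_singleton_iff]
      constructor
      · rintro ⟨hF, hFJ⟩
        obtain ⟨z, hz⟩ := hF.nonempty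
        exact hF.eq_of_mem hJ hz (hFJ hz)
      · rintro rfl
        exact ⟨hJ, Subset.rfl⟩
    simp [this]
  | insert e T heT ih =>
    rw [Finset.coe_insert] at hT ⊢
    obtain ⟨heG, heP⟩ := hT (mem_insert _ _)
    have hTG := (subset_insert _ _).trans hT
    obtain ⟨hfin, hcard⟩ := ih hTG
    have hS : (T ∪ P : Set (Sym2 V)) ⊆ G.edgeSet :=
      union_subset (hTG.trans sdiff_subset) hP
    have heS : e ∉ (T ∪ P : Set (Sym2 V)) := by
      rintro (h | h)
      · exact heT h
      · exact heP h
    obtain ⟨W, U₁, U₂, h⟩ : ∃ W U₁ U₂, E.IsSplit (T ∪ P) e W U₁ U₂ := by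
      induction e with
      | h u v =>
        exact E.exists_isSplit hS heG heS
          ((hconn u v).mono (fromEdgeSet_mono subset_union_right))
    have hiff := h.subset_iff subset_union_right hJ
    rw [insert_union]
    by_cases hWJ : W ⊆ J
    · have hnot : ∀ U : Set (ℝ × ℝ), U.Nonempty → U ⊆ W → U ∉ E.componentsIn (T ∪ P) J \ {W} := by
        rintro U ⟨z, hz⟩ hUW ⟨hU, hne⟩
        exact hne (hU.1.eq_of_mem h.comp hz (hUW hz))
      have h1 := hnot U₁ h.comp₁.nonempty h.subset₁
      have h2 := hnot U₂ h.comp₂.nonempty h.subset₂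
      have hfin' : (E.componentsIn (T ∪ P) J \ {W}).Finite := hfin.subset sdiff_subset
      have hset : {f ∈ insert e (T : Set (Sym2 V)) | (E.arc f ∩ J).Nonempty} =
          insert e {f ∈ (T : Set (Sym2 V)) | (E.arc f ∩ J).Nonempty} := by
        ext f
        simp only [mem_ofPred_eq, mem_insert_iff]
        constructor
        · tauto
        · rintro (rfl | hf)
          · exact ⟨Or.inl rfl, hiff.1 hWJ⟩
          · tauto
      rw [h.componentsIn_insert_of_subset hWJ, hset]
      refine ⟨(hfin'.insert _).insert _, ?_⟩
      rw [ncard_insert_of_notMem _ (hfin'.insert _), ncard_insert_of_notMem h2 hfin',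
        ncard_insert_of_notMem _ (toFinite _)]
      · have := ncard_sdiff_singleton_add_one (s := E.componentsIn (T ∪ P) J) (a := W)
          ⟨h.comp, hWJ⟩ hfin
        omega
      · exact fun hf => heT hf.1
      · rintro (hf | hf)
        · exact h.ne hf
        · exact h1 hf
    · have hset : {f ∈ insert e (T : Set (Sym2 V)) | (E.arc f ∩ J).Nonempty} =
          {f ∈ (T : Set (Sym2 V)) | (E.arc f ∩ J).Nonempty} := by
        ext f
        simp only [mem_ofPred_eq, mem_insert_iff]
        constructor
        · rintro ⟨rfl | hf, hfJ⟩
          · exact absurd (hiff.2 hfJ) hWJ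
          · exact ⟨hf, hfJ⟩
        · tauto
      have hcomp : E.componentsIn (insert e (T ∪ P)) J = E.componentsIn (T ∪ P) J := by
        ext F
        simp only [componentsIn, mem_ofPred_eq, h.isComplComponent_insert_iff]
        constructor
        · rintro ⟨⟨hF, -⟩ | rfl | rfl, hFJ⟩
          · exact ⟨hF, hFJ⟩
          · exact absurd (h.subset_of_subset subset_union_right hJ h.comp₁.nonempty h.subset₁
              hFJ) hWJ
          · exact absurd (h.subset_of_subset subset_union_right hJ h.comp₂.nonempty h.subset₂
              hFJ) hWJ
        · rintro ⟨hF, hFJ⟩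
          exact ⟨Or.inl ⟨hF, fun e => hWJ (e ▸ hFJ)⟩, hFJ⟩
      rw [hset, hcomp]
      exact ⟨hfin, hcard⟩

/-- The points used by the vertices and the edges of a walk. -/
def walkDrawing {u v : V} (q : G.Walk u v) : Set (ℝ × ℝ) :=
  E.vpos '' {w | w ∈ q.support} ∪ ⋃ e ∈ {e | e ∈ q.edges}, E.arc e

theorem isClosed_walkDrawing {u v : V} (q : G.Walk u v) : IsClosed (E.walkDrawing q) :=
  ((q.support.finite_toSet.image _).isClosed).union
    (q.edges.finite_toSet.isClosed_biUnion fun _ he =>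
      (E.isCompact_arc (q.edges_subset_edgeSet he)).isClosed)

theorem walkDrawing_cons {u v w : V} (h : G.Adj u v) (q : G.Walk v w) :
    E.walkDrawing (q.cons h) = E.arc s(u, v) ∪ E.walkDrawing q := by
  have hu : E.vpos u ∈ E.arc s(u, v) := E.vpos_mem_arc_of_mem h (Sym2.mem_mk_left u v)
  ext z
  simp only [walkDrawing, Walk.support_cons, Walk.edges_cons, List.mem_cons, mem_union, mem_image,
    mem_ofPred_eq, mem_iUnion, exists_prop]
  constructor
  · rintro (⟨x, rfl | hx, rfl⟩ | ⟨e, rfl | he, hz⟩)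
    · exact Or.inl hu
    · exact Or.inr (Or.inl ⟨x, hx, rfl⟩)
    · exact Or.inl hz
    · exact Or.inr (Or.inr ⟨e, he, hz⟩)
  · rintro (hz | ⟨x, hx, rfl⟩ | ⟨e, he, hz⟩)
    · exact Or.inr ⟨_, Or.inl rfl, hz⟩
    · exact Or.inl ⟨x, Or.inr hx, rfl⟩
    · exact Or.inr ⟨e, Or.inr he, hz⟩

theorem arc_inter_walkDrawing_subset {u v w : V} (h : G.Adj u v) {q : G.Walk v w}
    (hu : u ∉ q.support) : E.arc s(u, v) ∩ E.walkDrawing q ⊆ {E.vpos v} := by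
  rintro z ⟨hz, ⟨x, hx, rfl⟩ | hz'⟩
  · rcases Sym2.mem_iff.1 (E.vpos_mem_arc _ h x hz) with rfl | rfl
    · exact absurd hx hu
    · rfl
  · obtain ⟨e, he, hze⟩ := mem_iUnion₂.1 hz'
    have hue : u ∉ e := fun hue => hu (q.mem_support_of_mem_edges he hue)
    obtain ⟨x, hx, hxe, rfl⟩ := E.arc_inter _ h _ (q.edges_subset_edgeSet he)
      (fun heq => hue (heq ▸ Sym2.mem_mk_left u v)) ⟨hz, hze⟩
    rcases Sym2.mem_iff.1 hx with rfl | rfl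
    · exact absurd hxe hue
    · rfl

theorem hasContLog_walkDrawing {u v : V} {q : G.Walk u v} (hq : q.IsPath) {f : ℝ × ℝ → ℂ}
    (hf : ContinuousOn f (E.walkDrawing q)) (h0 : ∀ z ∈ E.walkDrawing q, f z ≠ 0) :
    HasContLog f (E.walkDrawing q) := by
  induction q with
  | @nil u =>
    have hs : E.walkDrawing (Walk.nil : G.Walk u u) = {E.vpos u} := by
      simp [walkDrawing, Set.image, eq_comm]
    rw [hs] at h0 ⊢
    refine (HasContLog.const (h0 _ rfl)).congr ?_
    rintro z rfl
    rfl
  | @cons u v w h q ih =>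
    obtain ⟨hq, hu⟩ := Walk.cons_isPath_iff h q |>.1 hq
    rw [E.walkDrawing_cons h q] at hf h0 ⊢
    refine HasContLog.union_of_inter_singleton (E.isCompact_arc h).isClosed
      (E.isClosed_walkDrawing q) (E.arc_inter_walkDrawing_subset h hu) ?_
      (ih hq (hf.mono subset_union_right) fun z hz => h0 z (Or.inr hz))
    obtain ⟨γ, hγ, hi, him, -⟩ := E.exists_param (h : s(u, v) ∈ G.edgeSet)
    rw [← him] at hf h0 ⊢
    exact HasContLog.of_arc hγ hi (hf.mono subset_union_left) fun z hz => h0 z (Or.inl hz)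

variable {a : V} {p : G.Walk a a}

theorem reachable_fromEdgeSet_edges {b : V} {p : G.Walk a b} (hp : ∀ v, v ∈ p.support) (u v : V) :
    (fromEdgeSet {e | e ∈ p.edges}).Reachable u v := by
  classical
  have ht : ∀ e ∈ p.edges, e ∈ (fromEdgeSet {e | e ∈ p.edges}).edgeSet := fun e he => by
    rw [edgeSet_fromEdgeSet]
    exact ⟨he, G.not_isDiag_of_mem_edgeSet (p.edges_subset_edgeSet he)⟩
  let q := p.transfer _ ht
  have hq : ∀ w, (fromEdgeSet {e | e ∈ p.edges}).Reachable a w := fun w =>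
    ⟨q.takeUntil w (by simpa [q] using hp w)⟩
  exact (hq u).symm.trans (hq v)

theorem reachable_fromEdgeSet_edges_sdiff (hp : p.IsCycle) {u v : V} (h : s(u, v) ∈ p.edges) :
    (fromEdgeSet ({e | e ∈ p.edges} \ {s(u, v)})).Reachable u v := by
  have ht : ∀ e ∈ p.edges, e ∈ (fromEdgeSet {e | e ∈ p.edges}).edgeSet := fun e he => by
    rw [edgeSet_fromEdgeSet]
    exact ⟨he, G.not_isDiag_of_mem_edgeSet (p.edges_subset_edgeSet he)⟩
  have := (adj_and_reachable_delete_edges_iff_exists_cycle (G := fromEdgeSet {e | e ∈ p.edges})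
    (v := u) (w := v)).2 ⟨a, p.transfer _ ht, hp.transfer ht, by simpa using h⟩
  refine this.2.mono ?_
  intro x y hxy
  simp only [deleteEdges_adj, fromEdgeSet_adj] at hxy ⊢
  exact ⟨⟨hxy.1.1, hxy.2⟩, hxy.1.2⟩

theorem curve_eq_partialDrawing (hp : p.IsCycle) (hs : ∀ v, v ∈ p.support) :
    E.curve p = E.partialDrawing {e | e ∈ p.edges} := by
  refine (union_eq_self_of_subset_left ?_).symm
  rintro _ ⟨v, rfl⟩
  obtain ⟨e, he, hv⟩ := (Walk.mem_support_iff_exists_mem_edges_of_not_nil hp.not_nil).1 (hs v)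
  exact mem_biUnion he (E.vpos_mem_arc_of_mem (p.edges_subset_edgeSet he) hv)

theorem exists_two_complComponents [Finite V] (hp : p.IsCycle) (hs : ∀ v, v ∈ p.support) :
    ∃ U₁ U₂, IsComplComponent (E.partialDrawing {e | e ∈ p.edges}) U₁ ∧
      IsComplComponent (E.partialDrawing {e | e ∈ p.edges}) U₂ ∧ U₁ ≠ U₂ ∧
      ∀ F, IsComplComponent (E.partialDrawing {e | e ∈ p.edges}) F → F = U₁ ∨ F = U₂ := by
  cases p with
  | nil => exact absurd hp Walk.not_isCycle_nil
  | @cons _ b _ h q =>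
    obtain ⟨hq, he⟩ := (Walk.cons_isCycle_iff q h).1 hp
    have hqs : ∀ v, v ∈ q.support := fun v => by
      have := hs v
      rw [Walk.support_cons, List.mem_cons] at this
      rcases this with rfl | hv
      · exact q.end_mem_support
      · exact hv
    have hqG : {e | e ∈ q.edges} ⊆ G.edgeSet := fun e he => q.edges_subset_edgeSet he
    have hdraw : E.walkDrawing q = E.partialDrawing {e | e ∈ q.edges} := by
      have : {w | w ∈ q.support} = univ := eq_univ_of_forall hqs
      rw [walkDrawing, this, image_univ]
      rfl
    have hins : {e | e ∈ (q.cons h).edges} = insert s(a, b) {e | e ∈ q.edges} := by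
      ext e
      simp
    rw [hins]
    obtain ⟨W, U₁, U₂, hW⟩ := E.exists_isSplit hqG h he
      (reachable_fromEdgeSet_edges hqs a b)
    refine ⟨U₁, U₂, hW.comp₁, hW.comp₂, hW.ne, fun F hF => hW.eq_or_eq F hF ?_⟩
    obtain ⟨z, hz⟩ := hF.nonempty
    have hzS : z ∉ E.partialDrawing {e | e ∈ q.edges} := fun hzS =>
      hF.subset_compl hz (E.partialDrawing_mono (subset_insert _ _) hzS)
    have hC := IsComplComponent.of_notMem hzS
    have : connectedComponentIn (E.partialDrawing {e | e ∈ q.edges})ᶜ z = W :=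
      IsComplComponent.eq_of_hasContLog (E.isCompact_partialDrawing hqG)
        (fun f hf h0 => by
          rw [← hdraw] at hf h0 ⊢
          exact E.hasContLog_walkDrawing hq hf h0) hC hW.comp
    exact ⟨z, hz, this ▸ mem_connectedComponentIn hzS⟩

theorem exists_inside_outside [Finite V] (hp : p.IsCycle) (hs : ∀ v, v ∈ p.support) :
    ∃ I O, IsComplComponent (E.partialDrawing {e | e ∈ p.edges}) I ∧
      IsComplComponent (E.partialDrawing {e | e ∈ p.edges}) O ∧
      Bornology.IsBounded I ∧ ¬ Bornology.IsBounded O ∧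
      ∀ F, IsComplComponent (E.partialDrawing {e | e ∈ p.edges}) F → F = I ∨ F = O := by
  obtain ⟨U₁, U₂, h₁, h₂, hne, htwo⟩ := E.exists_two_complComponents hp hs
  have hb : Bornology.IsBounded (E.partialDrawing {e | e ∈ p.edges}) :=
    (E.isCompact_partialDrawing fun e he => p.edges_subset_edgeSet he).isBounded
  by_cases hb₁ : Bornology.IsBounded U₁ <;> by_cases hb₂ : Bornology.IsBounded U₂
  · refine absurd (((hb₁.union hb₂).union hb).subset ?_) (NormedSpace.unbounded_univ ℝ (ℝ × ℝ))
    intro z _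
    by_cases hz : z ∈ E.partialDrawing {e | e ∈ p.edges}
    · exact Or.inr hz
    · left
      have hzC := mem_connectedComponentIn (F := (E.partialDrawing {e | e ∈ p.edges})ᶜ) hz
      rcases htwo _ (IsComplComponent.of_notMem hz) with h | h
      · exact Or.inl (h ▸ hzC)
      · exact Or.inr (h ▸ hzC)
  · exact ⟨U₁, U₂, h₁, h₂, hb₁, hb₂, htwo⟩
  · exact ⟨U₂, U₁, h₂, h₁, hb₂, hb₁, fun F hF => (htwo F hF).symm⟩
  · exact absurd (h₁.eq_of_not_isBounded h₂ hb hb₁ hb₂) hne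

theorem arc_subset_frontier_of_mem_edges [Finite V] (hp : p.IsCycle) (hs : ∀ v, v ∈ p.support)
    {e : Sym2 V} (he : e ∈ p.edges) {J : Set (ℝ × ℝ)}
    (hJ : IsComplComponent (E.partialDrawing {e | e ∈ p.edges}) J) : E.arc e ⊆ frontier J := by
  have hPG : {e | e ∈ p.edges} ⊆ G.edgeSet := fun e he => p.edges_subset_edgeSet he
  obtain ⟨W, U₁, U₂, hW⟩ : ∃ W U₁ U₂, E.IsSplit ({e | e ∈ p.edges} \ {e}) e W U₁ U₂ := by
    induction e with
    | h u v =>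
      exact E.exists_isSplit (sdiff_subset.trans hPG) (hPG he) (by simp)
        (reachable_fromEdgeSet_edges_sdiff hp he)
  have hins : insert e ({e | e ∈ p.edges} \ {e}) = {e | e ∈ p.edges} :=
    insert_sdiff_self_of_mem he
  have h₁ := hW.comp₁
  have h₂ := hW.comp₂
  rw [hins] at h₁ h₂
  have hJ' : J = U₁ ∨ J = U₂ := by
    obtain ⟨X, Y, -, -, -, htwo⟩ := E.exists_two_complComponents hp hs
    have := hW.ne
    rcases htwo _ h₁ with rfl | rfl <;> rcases htwo _ h₂ with rfl | rfl <;>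
      rcases htwo _ hJ with rfl | rfl <;> simp_all
  rcases hJ' with rfl | rfl
  · exact hW.frontier₁
  · exact hW.frontier₂

theorem exists_isSplit_edgeSet [Finite V] (hp : p.IsCycle) (hs : ∀ v, v ∈ p.support)
    {e : Sym2 V} (he : e ∈ G.edgeSet) :
    ∃ W U₁ U₂, E.IsSplit (G.edgeSet \ {e}) e W U₁ U₂ := by
  induction e with
  | h u v =>
    refine E.exists_isSplit sdiff_subset he (by simp) ?_
    by_cases hep : s(u, v) ∈ p.edges
    · exact (reachable_fromEdgeSet_edges_sdiff hp hep).mono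
        (fromEdgeSet_mono (sdiff_subset_sdiff_left fun e he => p.edges_subset_edgeSet he))
    · refine (reachable_fromEdgeSet_edges hs u v).mono (fromEdgeSet_mono fun e he => ?_)
      exact ⟨p.edges_subset_edgeSet he, fun h => hep (h ▸ he)⟩

/-- On each side of the cycle, every edge of the cycle bounds exactly one face. -/
theorem ncard_incident_of_mem_edges [Finite V] (hp : p.IsCycle) (hs : ∀ v, v ∈ p.support)
    {e : Sym2 V} (he : e ∈ p.edges) {J : Set (ℝ × ℝ)}
    (hJ : IsComplComponent (E.partialDrawing {e | e ∈ p.edges}) J) :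
    {F ∈ E.componentsIn G.edgeSet J | E.arc e ⊆ frontier F}.ncard = 1 := by
  have heG := p.edges_subset_edgeSet he
  obtain ⟨W, U₁, U₂, hW⟩ := E.exists_isSplit_edgeSet hp hs heG
  have hins : insert e (G.edgeSet \ {e}) = G.edgeSet := insert_sdiff_self_of_mem heG
  have hcl : ∀ K, IsComplComponent (E.partialDrawing {e | e ∈ p.edges}) K →
      U₁ ⊆ K ∨ U₂ ⊆ K := by
    intro K hK
    obtain ⟨z, hz, hzW⟩ := hW.inter_nonempty
    obtain ⟨w, hw, hwK⟩ := mem_closure_iff.1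
      (E.arc_subset_frontier_of_mem_edges hp hs he hK hz).1 W
      (hW.comp.isOpen (E.isCompact_partialDrawing sdiff_subset).isClosed) hzW
    have hwD : w ∉ E.partialDrawing (insert e (G.edgeSet \ {e})) := by
      rw [partialDrawing_insert]
      rintro (h | h)
      · exact hW.comp.subset_compl hw h
      · exact hK.subset_compl hwK (E.arc_subset_partialDrawing he h)
    have hC := IsComplComponent.of_notMem hwD
    have hwC := mem_connectedComponentIn (F := (E.partialDrawing _)ᶜ) hwD
    have hCK := hK.subset_of_isPreconnected hC.isPreconnected (hC.subset_compl.trans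
      (compl_subset_compl.2 (E.partialDrawing_mono
        (Subset.trans (fun f hf => p.edges_subset_edgeSet hf) hins.ge)))) hwK hwC
    rcases hW.eq_or_eq _ hC ⟨w, hwC, hw⟩ with h | h
    · exact Or.inl (h ▸ hCK)
    · exact Or.inr (h ▸ hCK)
  have hdisj : ∀ {K K' U : Set (ℝ × ℝ)}, IsComplComponent (E.partialDrawing {e | e ∈ p.edges}) K →
      IsComplComponent (E.partialDrawing {e | e ∈ p.edges}) K' → U.Nonempty → U ⊆ K → U ⊆ K' →
      K = K' := by
    rintro K K' U hK hK' ⟨z, hz⟩ h h'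
    exact hK.eq_of_mem hK' (h hz) (h' hz)
  obtain ⟨J', hJ', hne⟩ : ∃ J', IsComplComponent (E.partialDrawing {e | e ∈ p.edges}) J' ∧
      J ≠ J' := by
    obtain ⟨X, Y, hX, hY, hXY, -⟩ := E.exists_two_complComponents hp hs
    by_cases h : J = X
    · exact ⟨Y, hY, h ▸ hXY⟩
    · exact ⟨X, hX, h⟩
  have hmem : ∀ F, F ∈ {F ∈ E.componentsIn G.edgeSet J | E.arc e ⊆ frontier F} ↔
      (F = U₁ ∨ F = U₂) ∧ F ⊆ J := by
    intro F
    have h₁ := hW.comp₁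
    have h₂ := hW.comp₂
    have hiff := fun F => hW.arc_subset_frontier_iff sdiff_subset (F := F)
    rw [hins] at h₁ h₂ hiff
    simp only [componentsIn, mem_ofPred_eq]
    constructor
    · rintro ⟨⟨hF, hFJ⟩, hfr⟩
      exact ⟨(hiff F hF).1 hfr, hFJ⟩
    · rintro ⟨hF, hFJ⟩
      have hFc : IsComplComponent (E.partialDrawing G.edgeSet) F := by
        rcases hF with rfl | rfl <;> assumption
      exact ⟨⟨hFc, hFJ⟩, (hiff F hFc).2 hF⟩
  rw [ncard_eq_one]
  rcases hcl J hJ with h | h <;> rcases hcl J' hJ' with h' | h'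
  · exact absurd (hdisj hJ hJ' hW.comp₁.nonempty h h') hne
  · refine ⟨U₁, Set.ext fun F => (hmem F).trans ⟨?_, ?_⟩⟩
    · rintro ⟨rfl | rfl, hF⟩
      · rfl
      · exact absurd (hdisj hJ hJ' hW.comp₂.nonempty hF h') hne
    · rintro rfl
      exact ⟨Or.inl rfl, h⟩
  · refine ⟨U₂, Set.ext fun F => (hmem F).trans ⟨?_, ?_⟩⟩
    · rintro ⟨rfl | rfl, hF⟩
      · exact absurd (hdisj hJ hJ' hW.comp₁.nonempty hF h') hne
      · rfl
    · rintro rfl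
      exact ⟨Or.inr rfl, h⟩
  · exact absurd (hdisj hJ hJ' hW.comp₂.nonempty h h') hne

open Classical in
/-- A chord bounds two faces on the side of the cycle where it lies. -/
theorem ncard_incident_of_notMem_edges [Finite V] (hp : p.IsCycle) (hs : ∀ v, v ∈ p.support)
    {e : Sym2 V} (heG : e ∈ G.edgeSet) (he : e ∉ p.edges) {J : Set (ℝ × ℝ)}
    (hJ : IsComplComponent (E.partialDrawing {e | e ∈ p.edges}) J) :
    {F ∈ E.componentsIn G.edgeSet J | E.arc e ⊆ frontier F}.ncard =
      if (E.arc e ∩ J).Nonempty then 2 else 0 := by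
  obtain ⟨W, U₁, U₂, hW⟩ := E.exists_isSplit_edgeSet hp hs heG
  have hins : insert e (G.edgeSet \ {e}) = G.edgeSet := insert_sdiff_self_of_mem heG
  have hPS : {e | e ∈ p.edges} ⊆ G.edgeSet \ {e} := fun f hf =>
    ⟨p.edges_subset_edgeSet hf, fun h => he (h ▸ hf)⟩
  have hsub := hW.subset_iff hPS hJ
  have h₁ := hW.comp₁
  have h₂ := hW.comp₂
  have hiff := fun F => hW.arc_subset_frontier_iff sdiff_subset (F := F)
  rw [hins] at h₁ h₂ hiff
  split_ifs with hne
  · rw [ncard_eq_two]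
    have hWJ := hsub.2 hne
    refine ⟨U₁, U₂, hW.ne, Set.ext fun F => ?_⟩
    simp only [componentsIn, mem_ofPred_eq, mem_insert_iff, mem_singleton_iff]
    constructor
    · rintro ⟨⟨hF, -⟩, hfr⟩
      exact (hiff F hF).1 hfr
    · rintro (rfl | rfl)
      · exact ⟨⟨h₁, hW.subset₁.trans hWJ⟩, hW.frontier₁⟩
      · exact ⟨⟨h₂, hW.subset₂.trans hWJ⟩, hW.frontier₂⟩
  · convert ncard_empty (Set (ℝ × ℝ)) using 2
    refine eq_empty_of_forall_notMem ?_
    rintro F ⟨⟨hF, hFJ⟩, hfr⟩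
    refine hne (hsub.1 ?_)
    rcases (hiff F hF).1 hfr with rfl | rfl
    · exact hW.subset_of_subset hPS hJ h₁.nonempty hW.subset₁ hFJ
    · exact hW.subset_of_subset hPS hJ h₂.nonempty hW.subset₂ hFJ

theorem ncard_componentsIn_edgeSet [Finite V] (hs : ∀ v, v ∈ p.support) {J : Set (ℝ × ℝ)}
    (hJ : IsComplComponent (E.partialDrawing {e | e ∈ p.edges}) J) :
    (E.componentsIn G.edgeSet J).Finite ∧ (E.componentsIn G.edgeSet J).ncard =
      1 + {e ∈ G.edgeSet \ {e | e ∈ p.edges} | (E.arc e ∩ J).Nonempty}.ncard := by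
  have hfin : (G.edgeSet \ {e | e ∈ p.edges}).Finite := toFinite _
  have hPG : {e | e ∈ p.edges} ⊆ G.edgeSet := fun e he => p.edges_subset_edgeSet he
  have := E.ncard_componentsIn hPG (reachable_fromEdgeSet_edges hs) hJ hfin.toFinset (by simp)
  rwa [hfin.coe_toFinset, sdiff_union_of_subset hPG] at this

/-- The sum of `faceSize F - 2` over the faces on one side of the cycle. -/
theorem sum_faceSize_sub_two [Finite V] (hp : p.IsCycle) (hs : ∀ v, v ∈ p.support)
    {J : Set (ℝ × ℝ)} (hJ : IsComplComponent (E.partialDrawing {e | e ∈ p.edges}) J)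
    {N : Finset (Set (ℝ × ℝ))} (hN : (N : Set (Set (ℝ × ℝ))) = E.componentsIn G.edgeSet J) :
    ∑ F ∈ N, ((E.faceSize F : ℤ) - 2) = ({e | e ∈ p.edges}.ncard : ℤ) - 2 := by
  classical
  obtain ⟨-, hcard⟩ := E.ncard_componentsIn_edgeSet hs hJ
  rw [← hN, ncard_coe_finset] at hcard
  have hG : G.edgeSet.Finite := toFinite _
  set M := hG.toFinset with hM
  have hMmem : ∀ e, e ∈ M ↔ e ∈ G.edgeSet := fun e => hG.mem_toFinset
  have hface : ∀ F, E.faceSize F = (M.filter fun e => E.arc e ⊆ frontier F).card := by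
    intro F
    rw [faceSize, ← ncard_coe_finset]
    congr 1
    ext e
    simp [hMmem]
  have hinc : ∀ e ∈ M, (N.filter fun F => E.arc e ⊆ frontier F).card =
      (if e ∈ p.edges then 1 else 0) +
        2 * (if e ∉ p.edges ∧ (E.arc e ∩ J).Nonempty then 1 else 0) := by
    intro e he
    have hset : ((N.filter fun F => E.arc e ⊆ frontier F : Finset _) : Set (Set (ℝ × ℝ))) =
        {F ∈ E.componentsIn G.edgeSet J | E.arc e ⊆ frontier F} := by
      rw [← hN]
      ext F
      simp
    rw [← ncard_coe_finset, hset]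
    by_cases hep : e ∈ p.edges
    · simp [hep, E.ncard_incident_of_mem_edges hp hs hep hJ]
    · rw [E.ncard_incident_of_notMem_edges hp hs ((hMmem e).1 he) hep hJ]
      by_cases hne : (E.arc e ∩ J).Nonempty <;> simp [hep, hne]
  have hcycle : (M.filter fun e => e ∈ p.edges).card = {e | e ∈ p.edges}.ncard := by
    rw [← ncard_coe_finset]
    congr 1
    ext e
    simpa [hMmem] using fun he => p.edges_subset_edgeSet he
  have hchord : (M.filter fun e => e ∉ p.edges ∧ (E.arc e ∩ J).Nonempty).card =
      {e ∈ G.edgeSet \ {e | e ∈ p.edges} | (E.arc e ∩ J).Nonempty}.ncard := by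
    rw [← ncard_coe_finset]
    congr 1
    ext e
    simp [hMmem, and_assoc]
  have hsum : ∑ F ∈ N, E.faceSize F = {e | e ∈ p.edges}.ncard +
      2 * {e ∈ G.edgeSet \ {e | e ∈ p.edges} | (E.arc e ∩ J).Nonempty}.ncard := by
    simp_rw [hface]
    have := Finset.sum_card_bipartiteAbove_eq_sum_card_bipartiteBelow (s := N) (t := M)
      (fun F e => E.arc e ⊆ frontier F)
    simp only [Finset.bipartiteAbove, Finset.bipartiteBelow] at this
    rw [this, Finset.sum_congr rfl hinc, Finset.sum_add_distrib, ← Finset.mul_sum,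
      ← Finset.card_filter, ← Finset.card_filter, hcycle, hchord]
  rw [Finset.sum_sub_distrib, ← Nat.cast_sum, hsum, Finset.sum_const, hcard]
  push_cast
  ring

theorem sum_mul_ncard_faceSize [Finite V] (hp : p.IsCycle) (hs : ∀ v, v ∈ p.support)
    {J : Set (ℝ × ℝ)} (hJ : IsComplComponent (E.partialDrawing {e | e ∈ p.edges}) J) :
    ∑ i ∈ Finset.range (G.edgeSet.ncard + 1), ((i : ℤ) - 2) *
      ({F ∈ E.componentsIn G.edgeSet J | E.faceSize F = i}.ncard : ℤ) =
      ({e | e ∈ p.edges}.ncard : ℤ) - 2 := by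
  obtain ⟨hfin, -⟩ := E.ncard_componentsIn_edgeSet hs hJ
  rw [← E.sum_faceSize_sub_two hp hs hJ hfin.coe_toFinset]
  rw [← Finset.sum_fiberwise_of_maps_to (t := Finset.range (G.edgeSet.ncard + 1))
    (g := E.faceSize) fun F _ => Finset.mem_range_succ_iff.2
      (ncard_le_ncard (fun e he => he.1) (toFinite _))]
  refine Finset.sum_congr rfl fun i _ => ?_
  have hset : {F ∈ E.componentsIn G.edgeSet J | E.faceSize F = i} =
      (hfin.toFinset.filter fun F => E.faceSize F = i : Finset _) := by
    ext F
    simp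
  rw [hset, ncard_coe_finset, Finset.sum_congr rfl fun F hF => by
    rw [(Finset.mem_filter.1 hF).2], Finset.sum_const, nsmul_eq_mul, mul_comm]

theorem isFace_and_forall_connectedComponentIn_iff (hp : p.IsCycle) (hs : ∀ v, v ∈ p.support)
    {J F : Set (ℝ × ℝ)} (hJ : IsComplComponent (E.partialDrawing {e | e ∈ p.edges}) J)
    {r : Set (ℝ × ℝ) → Prop} (hr : ∀ K,
      IsComplComponent (E.partialDrawing {e | e ∈ p.edges}) K → (r K ↔ K = J)) :
    (E.IsFace F ∧ ∀ x ∈ F, r (connectedComponentIn (E.curve p)ᶜ x)) ↔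
      F ∈ E.componentsIn G.edgeSet J := by
  rw [E.curve_eq_partialDrawing hp hs]
  refine and_congr_right fun hF => ?_
  have hF : IsComplComponent (E.partialDrawing G.edgeSet) F := hF
  have hFP : ∀ x ∈ F, x ∉ E.partialDrawing {e | e ∈ p.edges} := fun x hx h =>
    hF.subset_compl hx (E.partialDrawing_mono (fun e he => p.edges_subset_edgeSet he) h)
  constructor
  · intro h x hx
    rw [← (hr _ (IsComplComponent.of_notMem (hFP x hx))).1 (h x hx)]
    exact mem_connectedComponentIn (hFP x hx)
  · intro h x hx
    rw [← hJ.eq_connectedComponentIn (h hx)]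
    exact (hr J hJ).2 rfl

end SimpleGraph.PlaneEmbedding

/-- Grinberg's criterion: if a plane graph has a Hamiltonian cycle `p`, and `f i`
(resp. `g i`) is the number of faces of size `i` inside (resp. outside) the cycle, then
`∑ (i - 2) * (f i - g i) = 0`. -/
theorem grinberg_criterion {V : Type*} [Fintype V] [DecidableEq V] {G : SimpleGraph V}
    (E : G.PlaneEmbedding) {a : V} (p : G.Walk a a) (hp : p.IsHamiltonianCycle) :
    ∑ i ∈ Finset.range (G.edgeSet.ncard + 1),
      ((i : ℤ) - 2) *
        (({F : Set (ℝ × ℝ) | E.IsFace F ∧ E.FaceInside p F ∧ E.faceSize F = i}.ncard : ℤ) -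
         ({F : Set (ℝ × ℝ) | E.IsFace F ∧ E.FaceOutside p F ∧ E.faceSize F = i}.ncard : ℤ)) = 0 := by
  have hc := hp.isCycle
  have hs := hp.mem_support
  obtain ⟨I, O, hI, hO, hbI, hbO, htwo⟩ := E.exists_inside_outside hc hs
  have hin : ∀ i, {F | E.IsFace F ∧ E.FaceInside p F ∧ E.faceSize F = i} =
      {F ∈ E.componentsIn G.edgeSet I | E.faceSize F = i} := fun i => by
    ext F
    rw [mem_ofPred_eq, mem_ofPred_eq, ← and_assoc]
    refine and_congr_left fun _ => E.isFace_and_forall_connectedComponentIn_iff hc hs hI ?_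
    refine fun K hK => ⟨fun h => (htwo K hK).resolve_right ?_, fun h => h ▸ hbI⟩
    rintro rfl
    exact hbO h
  have hout : ∀ i, {F | E.IsFace F ∧ E.FaceOutside p F ∧ E.faceSize F = i} =
      {F ∈ E.componentsIn G.edgeSet O | E.faceSize F = i} := fun i => by
    ext F
    rw [mem_ofPred_eq, mem_ofPred_eq, ← and_assoc]
    refine and_congr_left fun _ => E.isFace_and_forall_connectedComponentIn_iff hc hs hO
      (r := fun K => ¬ Bornology.IsBounded K) ?_
    refine fun K hK => ⟨fun h => (htwo K hK).resolve_left ?_, fun h => h ▸ hbO⟩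
    rintro rfl
    exact h hbI
  simp_rw [hin, hout, mul_sub, Finset.sum_sub_distrib]
  rw [E.sum_mul_ncard_faceSize hc hs hI, E.sum_mul_ncard_faceSize hc hs hO, sub_self]
end
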